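/- arXiv:2506.14118 — 2 statements merged into one kernel-verified Lean document; each statement's English description precedes it below -/
import Mathlib

section
/- Let Q ⊂ ℝ² be a toric diagram with exactly four extreme points that is not a parallelogram, let d₁, d₂, d₃, d₄ ∈ ℤ² be the oriented edge vectors of Q obtained by traversing its boundary counterclockwise (so that d₁ + d₂ + d₃ + d₄ = 0), and let L be a lattice segment with edge vector w such that Q + L is a toric diagram. Then Q + L admits a lattice maximal Minkowski decomposition if and only if dᵢ + dⱼ = w or dᵢ + dⱼ = −w for some 1 ≤ i < j ≤ 4; moreover, in that case every lattice maximal Minkowski decomposition of Q + L is a Minkowski sum of exactly two lattice triangles. -/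
open Set Pointwise

noncomputable section

/-- We work in the plane `ℝ × ℝ`. -/
abbrev V : Type := ℝ × ℝ

/-- The embedding of the lattice `ℤ × ℤ` into the plane. -/
def toR (p : ℤ × ℤ) : V := ((p.1 : ℝ), (p.2 : ℝ))

/-- The set of lattice points of the plane. -/
def latticePoints : Set V := Set.range toR

/-- A lattice polytope: the convex hull of a nonempty finite set of lattice points. -/
def IsLatticePolytope (P : Set V) : Prop :=
  ∃ S : Finset (ℤ × ℤ), S.Nonempty ∧ P = convexHull ℝ (toR '' ↑S)

/-- A toric diagram: a two-dimensional lattice polytope such that every lattice point on its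
topological boundary is an extreme point. -/
def IsToricDiagram (P : Set V) : Prop :=
  IsLatticePolytope P ∧ (interior P).Nonempty ∧
    ∀ x ∈ frontier P, x ∈ latticePoints → x ∈ P.extremePoints ℝ

/-- A lattice segment: the convex hull of two distinct lattice points. -/
def IsLatticeSegment (L : Set V) : Prop :=
  ∃ a b : ℤ × ℤ, a ≠ b ∧ L = segment ℝ (toR a) (toR b)

/-- A lattice triangle: the convex hull of three affinely independent lattice points. -/
def IsLatticeTriangle (T : Set V) : Prop :=
  ∃ a b c : ℤ × ℤ, AffineIndependent ℝ ![toR a, toR b, toR c] ∧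
    T = convexHull ℝ {toR a, toR b, toR c}

/-- `E` is an edge of `P`: a maximal (nondegenerate) line segment contained in the
topological boundary of `P`. -/
def IsEdge (P E : Set V) : Prop :=
  (∃ a b : V, a ≠ b ∧ E = segment ℝ a b) ∧ E ⊆ frontier P ∧
    ∀ F : Set V, (∃ a b : V, F = segment ℝ a b) → F ⊆ frontier P → E ⊆ F → F = E

/-- `v` is an edge vector of `P` (the difference of the endpoints of some edge of `P`). -/
def IsEdgeVector (P : Set V) (v : V) : Prop :=
  ∃ a b : V, a ≠ b ∧ IsEdge P (segment ℝ a b) ∧ v = b - a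

/-- Two plane vectors are parallel when their cross product vanishes. -/
def Par (v w : V) : Prop := v.1 * w.2 = v.2 * w.1

/-- `P` admits a lattice maximal Minkowski decomposition: `P` is a Minkowski sum of at
least two lattice polytopes, each of which is a lattice segment or a lattice triangle. -/
def HasLatticeMaximalDecomposition (P : Set V) : Prop :=
  ∃ (m : ℕ) (Ps : Fin (m + 1) → Set V), 1 ≤ m ∧
    P = ∑ k, Ps k ∧ ∀ k, IsLatticeSegment (Ps k) ∨ IsLatticeTriangle (Ps k)

/-- A convex polytope: the convex hull of a nonempty finite set of points. -/
def IsConvexPolytope (A : Set V) : Prop :=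
  ∃ S : Finset V, S.Nonempty ∧ A = convexHull ℝ (↑S : Set V)

/-- `A` is a homothet `λ • P + t` (`λ > 0`) of `P`. -/
def IsHomothet (A P : Set V) : Prop :=
  ∃ (l : ℝ) (t : V), 0 < l ∧ A = (fun x => l • x + t) '' P

/-- A (nondegenerate) line segment. -/
def IsSegmentSet (A : Set V) : Prop := ∃ a b : V, a ≠ b ∧ A = segment ℝ a b

/-- A triangle: the convex hull of three affinely independent points. -/
def IsTriangleSet (A : Set V) : Prop :=
  ∃ a b c : V, AffineIndependent ℝ ![a, b, c] ∧ A = convexHull ℝ {a, b, c}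

/-- A convex polytope is Minkowski-indecomposable if in every Minkowski decomposition
into two convex polytopes, one of the summands is a point or a homothet of the polytope. -/
def MinkowskiIndecomposable (Q : Set V) : Prop :=
  ∀ A B : Set V, IsConvexPolytope A → IsConvexPolytope B → Q = A + B →
    (∃ x, A = {x}) ∨ IsHomothet A Q ∨ (∃ x, B = {x}) ∨ IsHomothet B Q

/-- A parallelogram: a quadrilateral whose vertices `v₁ v₂ v₃ v₄` in cyclic order satisfy
`v₁ + v₃ = v₂ + v₄`. -/
def IsParallelogram (P : Set V) : Prop :=
  ∃ w : Fin 4 → V, Function.Injective w ∧ P.extremePoints ℝ = Set.range w ∧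
    w 0 + w 2 = w 1 + w 3

/-- The Gauntlett–Martelli–Sparks–Waldram toric diagram `𝒴^{p,q}`. -/
def GMSW (p q : ℤ) : Set V :=
  convexHull ℝ (toR '' ({(0, 0), (1, 0), (p, p), (p - q - 1, p - q)} : Set (ℤ × ℤ)))

/-- Cross product of lattice vectors. -/
def crossZ (u w : ℤ × ℤ) : ℤ := u.1 * w.2 - u.2 * w.1

/-- The real cross product of two plane vectors. -/
def cr (u w : V) : ℝ := u.1 * w.2 - u.2 * w.1

theorem cr_add_right (u x y : V) : cr u (x + y) = cr u x + cr u y := by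
  simp only [cr, Prod.fst_add, Prod.snd_add]; ring

theorem cr_smul_right (u x : V) (t : ℝ) : cr u (t • x) = t * cr u x := by
  simp only [cr, Prod.smul_fst, Prod.smul_snd, smul_eq_mul]; ring

theorem cr_smul_left (u x : V) (t : ℝ) : cr (t • u) x = t * cr u x := by
  simp only [cr, Prod.smul_fst, Prod.smul_snd, smul_eq_mul]; ring

theorem cr_sub_right (u x y : V) : cr u (x - y) = cr u x - cr u y := by
  simp only [cr, Prod.fst_sub, Prod.snd_sub]; ring

theorem cr_self (u : V) : cr u u = 0 := by simp only [cr]; ring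

theorem cr_toR (u w : ℤ × ℤ) : cr (toR u) (toR w) = (crossZ u w : ℝ) := by
  simp [cr, toR, crossZ]

theorem toR_add (p q : ℤ × ℤ) : toR (p + q) = toR p + toR q := by simp [toR]

theorem toR_sub (p q : ℤ × ℤ) : toR (p - q) = toR p - toR q := by simp [toR]

theorem toR_neg (p : ℤ × ℤ) : toR (-p) = -toR p := by simp [toR]

theorem toR_zero : toR 0 = 0 := by simp [toR]

theorem toR_injective : Function.Injective toR := by
  rintro ⟨a, b⟩ ⟨c, d⟩ h
  simpa [toR] using h

theorem toR_ne_zero {p : ℤ × ℤ} (h : p ≠ 0) : toR p ≠ 0 := fun h' =>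
  h (toR_injective (h'.trans toR_zero.symm))

/-- The face of `P` on which `cr d` is minimal is the segment from `p` to `p + t • d`. -/
structure IsFace (P : Set V) (d p : V) (t : ℝ) : Prop where
  mem : p ∈ P
  mem_add : p + t • d ∈ P
  nonneg : 0 ≤ t
  le : ∀ x ∈ P, cr d p ≤ cr d x
  eq : ∀ x ∈ P, cr d x = cr d p → ∃ s, 0 ≤ s ∧ s ≤ t ∧ x = p + s • d

/-- `E` enumerates the edge vectors of the polygon `P`, traversed counterclockwise. -/
structure HasEdges {ι : Type*} (P : Set V) (E : ι → ℤ × ℤ) : Prop where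
  ne_zero : ∀ i, E i ≠ 0
  edge : ∀ i, ∃ p : ℤ × ℤ, IsFace P (toR (E i)) (toR p) 1
  face : ∀ d : V, d ≠ 0 → ∃ (p : ℤ × ℤ) (t : ℝ), IsFace P d (toR p) t ∧
    (0 < t → ∃ i, toR (E i) = t • d)

theorem IsFace.length_unique {P : Set V} {d p q : V} {s t : ℝ} (hd : d ≠ 0)
    (h : IsFace P d p s) (h' : IsFace P d q t) : s = t := by
  have key : ∀ {p q : V} {s t : ℝ}, IsFace P d p s → IsFace P d q t → s ≤ t := by
    intro p q s t h h'
    have hpq : cr d p = cr d q := le_antisymm (h.le _ h'.mem) (h'.le _ h.mem)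
    obtain ⟨u, hu, -, hpu⟩ := h'.eq p h.mem hpq
    obtain ⟨r, -, hr, hpr⟩ := h'.eq _ h.mem_add
      (by rw [cr_add_right, cr_smul_right, cr_self]; linarith)
    have h1 : (u + s - r) • d = 0 := by
      have : p + s • d - (q + r • d) = 0 := sub_eq_zero.2 hpr
      rw [hpu] at this
      rw [← this]; module
    rcases smul_eq_zero.1 h1 with h2 | h2
    · linarith
    · exact absurd h2 hd
  exact le_antisymm (key h h') (key h' h)

theorem IsFace.add {A B : Set V} {d p q : V} {s t : ℝ}
    (h : IsFace A d p s) (h' : IsFace B d q t) : IsFace (A + B) d (p + q) (s + t) where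
  mem := Set.add_mem_add h.mem h'.mem
  mem_add := by
    have := Set.add_mem_add h.mem_add h'.mem_add
    convert this using 1
    module
  nonneg := add_nonneg h.nonneg h'.nonneg
  le := by
    rintro _ ⟨x, hx, y, hy, rfl⟩
    simp only [cr_add_right]
    exact add_le_add (h.le x hx) (h'.le y hy)
  eq := by
    rintro _ ⟨x, hx, y, hy, rfl⟩ hxy
    simp only [cr_add_right] at hxy
    have h1 := h.le x hx
    have h2 := h'.le y hy
    obtain ⟨u, hu, hu', rfl⟩ := h.eq x hx (by linarith)
    obtain ⟨r, hr, hr', rfl⟩ := h'.eq y hy (by linarith)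
    exact ⟨u + r, by linarith, by linarith, by module⟩

theorem IsFace.sum {κ : Type*} (S : Finset κ) {P : κ → Set V} {d : V} {p : κ → V} {t : κ → ℝ}
    (h : ∀ k, IsFace (P k) d (p k) (t k)) :
    IsFace (∑ k ∈ S, P k) d (∑ k ∈ S, p k) (∑ k ∈ S, t k) := by
  classical
  induction S using Finset.induction_on with
  | empty =>
    simp only [Finset.sum_empty]
    refine ⟨by simp, by simp, le_rfl, ?_, ?_⟩
    · intro x hx
      rw [Set.mem_zero.1 hx]
    · intro x hx _
      exact ⟨0, le_rfl, le_rfl, by simpa using hx⟩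
  | insert a S ha ih =>
    simp only [Finset.sum_insert ha]
    exact (h a).add ih

theorem eq_smul_of_cr_eq_zero {d x : V} (hd : d ≠ 0) (h : cr d x = 0) :
    x = ((d.1 * x.1 + d.2 * x.2) / (d.1 ^ 2 + d.2 ^ 2)) • d := by
  have hpos : d.1 ^ 2 + d.2 ^ 2 ≠ 0 := by
    intro h0
    apply hd
    ext
    · simp; nlinarith [sq_nonneg d.1, sq_nonneg d.2]
    · simp; nlinarith [sq_nonneg d.1, sq_nonneg d.2]
  simp only [cr] at h
  ext
  · simp only [Prod.smul_fst, smul_eq_mul]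
    field_simp
    linear_combination (-d.2) * h
  · simp only [Prod.smul_snd, smul_eq_mul]
    field_simp
    linear_combination d.1 * h

theorem IsFace.hull {S : Set V} {d p : V} {t : ℝ} (h : IsFace S d p t) :
    IsFace (convexHull ℝ S) d p t := by
  have hsub : convexHull ℝ S ⊆
      {x | cr d p ≤ cr d x ∧ (cr d x = cr d p → ∃ s, 0 ≤ s ∧ s ≤ t ∧ x = p + s • d)} := by
    refine convexHull_min (fun x hx => ⟨h.le x hx, h.eq x hx⟩) ?_
    intro x hx y hy a b ha hb hab
    obtain ⟨hx1, hx2⟩ := hx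
    obtain ⟨hy1, hy2⟩ := hy
    rcases ha.eq_or_lt with rfl | ha'
    · obtain rfl : b = 1 := by linarith
      simpa using And.intro hy1 hy2
    rcases hb.eq_or_lt with rfl | hb'
    · obtain rfl : a = 1 := by linarith
      simpa using And.intro hx1 hx2
    obtain rfl : b = 1 - a := by linarith
    simp only [Set.mem_ofPred_eq, cr_add_right, cr_smul_right]
    refine ⟨by nlinarith, fun he => ?_⟩
    obtain ⟨s, hs, hs', rfl⟩ := hx2 (by nlinarith)
    obtain ⟨r, hr, hr', rfl⟩ := hy2 (by nlinarith)
    exact ⟨a * s + (1 - a) * r, by positivity, by nlinarith, by module⟩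
  exact ⟨subset_convexHull ℝ S h.mem, subset_convexHull ℝ S h.mem_add, h.nonneg,
    fun x hx => (hsub hx).1, fun x hx => (hsub hx).2⟩

theorem exists_isFace_range {n : ℕ} [NeZero n] (v : Fin n → V) {d : V} (hd : d ≠ 0) :
    ∃ i j t, v j = v i + t • d ∧ IsFace (Set.range v) d (v i) t := by
  have hpos : 0 < d.1 ^ 2 + d.2 ^ 2 := by
    rcases lt_or_eq_of_le (add_nonneg (sq_nonneg d.1) (sq_nonneg d.2)) with h0 | h0
    · exact h0
    · refine absurd ?_ hd
      ext
      · simp; nlinarith [sq_nonneg d.1, sq_nonneg d.2]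
      · simp; nlinarith [sq_nonneg d.1, sq_nonneg d.2]
  let g : V → ℝ := fun x => d.1 * x.1 + d.2 * x.2
  have hg : ∀ x y, g (x - y) = g x - g y := fun x y => by simp [g]; ring
  obtain ⟨i₀, -, hi₀⟩ := Finset.exists_min_image Finset.univ (fun i => cr d (v i))
    ⟨0, Finset.mem_univ _⟩
  let S := Finset.univ.filter (fun i => cr d (v i) = cr d (v i₀))
  have hS : S.Nonempty := ⟨i₀, by simp [S]⟩
  obtain ⟨i, hi, hmin⟩ := Finset.exists_min_image S (fun i => g (v i)) hS
  obtain ⟨j, hj, hmax⟩ := Finset.exists_max_image S (fun i => g (v i)) hS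
  simp only [S, Finset.mem_filter, Finset.mem_univ, true_and, forall_const] at hi hj hmin hmax hi₀
  have key : ∀ k, cr d (v k) = cr d (v i₀) →
      v k = v i + ((g (v k) - g (v i)) / (d.1 ^ 2 + d.2 ^ 2)) • d := by
    intro k hk
    have := eq_smul_of_cr_eq_zero hd (x := v k - v i) (by rw [cr_sub_right]; linarith)
    rw [← hg]
    simp only [g]
    rw [← this]; abel
  refine ⟨i, j, _, key j hj, ⟨⟨i, rfl⟩, ⟨j, key j hj⟩, ?_, ?_, ?_⟩⟩
  · exact div_nonneg (sub_nonneg.2 (hmin j hj)) hpos.le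
  · rintro _ ⟨k, rfl⟩
    rw [hi]; exact hi₀ k
  · rintro _ ⟨k, rfl⟩ hk
    rw [hi] at hk
    refine ⟨_, div_nonneg (sub_nonneg.2 (hmin k hk)) hpos.le, ?_, key k hk⟩
    have := hmax k hk
    gcongr

theorem hasEdges_of_cyclic {n : ℕ} [NeZero n] (v : Fin n → ℤ × ℤ)
    (hne : ∀ i, v (i + 1) - v i ≠ 0)
    (hv : ∀ i j, 0 ≤ crossZ (v (i + 1) - v i) (v j - v i) ∧
      (crossZ (v (i + 1) - v i) (v j - v i) = 0 → j = i ∨ j = i + 1)) :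
    HasEdges (convexHull ℝ (toR '' Set.range v)) (fun i => v (i + 1) - v i) where
  ne_zero := hne
  edge := by
    intro i
    refine ⟨v i, IsFace.hull ⟨⟨_, ⟨i, rfl⟩, rfl⟩, ⟨_, ⟨i + 1, rfl⟩, ?_⟩, zero_le_one, ?_, ?_⟩⟩
    · rw [toR_sub]; module
    · rintro _ ⟨_, ⟨j, rfl⟩, rfl⟩
      rw [← sub_nonneg, ← cr_sub_right, ← toR_sub, cr_toR]
      exact_mod_cast (hv i j).1
    · rintro _ ⟨_, ⟨j, rfl⟩, rfl⟩ hj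
      rw [← sub_eq_zero, ← cr_sub_right, ← toR_sub, cr_toR] at hj
      rcases (hv i j).2 (by exact_mod_cast hj) with rfl | rfl
      · exact ⟨0, le_rfl, zero_le_one, by simp⟩
      · exact ⟨1, zero_le_one, le_rfl, by rw [toR_sub]; module⟩
  face := by
    intro d hd
    obtain ⟨i, j, t, hij, hF⟩ := exists_isFace_range (fun i => toR (v i)) hd
    rw [Set.range_comp' toR v] at hF
    refine ⟨_, t, hF.hull, fun ht => ⟨i, ?_⟩⟩
    have htd : t • d = toR (v j - v i) := by rw [toR_sub, hij]; module
    have h1 : cr d (toR (v (i + 1) - v i)) ≥ 0 := by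
      rw [toR_sub, cr_sub_right]
      linarith [hF.le (toR (v (i + 1))) ⟨_, ⟨_, rfl⟩, rfl⟩]
    have h2 : 0 ≤ cr (toR (v j - v i)) (toR (v (i + 1) - v i)) := by
      rw [← htd, cr_smul_left]; positivity
    rw [cr_toR] at h2
    have h3 : 0 ≤ crossZ (v j - v i) (v (i + 1) - v i) := by exact_mod_cast h2
    have h4 := (hv i j).1
    have h5 : crossZ (v (i + 1) - v i) (v j - v i) = - crossZ (v j - v i) (v (i + 1) - v i) := by
      simp only [crossZ]; ring
    rcases (hv i j).2 (by omega) with rfl | rfl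
    · rw [sub_self, toR_zero] at htd
      exact absurd htd (smul_ne_zero ht.ne' hd)
    · exact htd.symm

theorem HasEdges.add {ι κ : Type*} {A B : Set V} {E : ι → ℤ × ℤ} {F : κ → ℤ × ℤ}
    (hA : HasEdges A E) (hB : HasEdges B F) (hEF : ∀ i j, crossZ (E i) (F j) ≠ 0) :
    HasEdges (A + B) (Sum.elim E F) where
  ne_zero := by
    rintro (i | j)
    · exact hA.ne_zero i
    · exact hB.ne_zero j
  edge := by
    rintro (i | j)
    · obtain ⟨p, hp⟩ := hA.edge i
      obtain ⟨q, t, hF, ht⟩ := hB.face _ (toR_ne_zero (hA.ne_zero i))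
      obtain rfl : t = 0 := by
        by_contra h0
        obtain ⟨j, hj⟩ := ht (lt_of_le_of_ne hF.nonneg (Ne.symm h0))
        apply hEF i j
        have : cr (toR (E i)) (toR (F j)) = 0 := by rw [hj, cr_smul_right, cr_self, mul_zero]
        rw [cr_toR] at this
        exact_mod_cast this
      exact ⟨p + q, by simpa [toR_add] using hp.add hF⟩
    · obtain ⟨p, hp⟩ := hB.edge j
      obtain ⟨q, t, hF, ht⟩ := hA.face _ (toR_ne_zero (hB.ne_zero j))
      obtain rfl : t = 0 := by
        by_contra h0
        obtain ⟨i, hi⟩ := ht (lt_of_le_of_ne hF.nonneg (Ne.symm h0))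
        apply hEF i j
        have : cr (toR (E i)) (toR (F j)) = 0 := by rw [hi, cr_smul_left, cr_self, mul_zero]
        rw [cr_toR] at this
        exact_mod_cast this
      exact ⟨q + p, by simpa [toR_add] using hF.add hp⟩
  face := by
    intro d hd
    obtain ⟨p, s, hF, hs⟩ := hA.face d hd
    obtain ⟨q, t, hF', ht⟩ := hB.face d hd
    refine ⟨p + q, s + t, by simpa [toR_add] using hF.add hF', fun hst => ?_⟩
    rcases hF.nonneg.eq_or_lt with rfl | hs'
    · obtain ⟨j, hj⟩ := ht (by simpa using hst)
      exact ⟨Sum.inr j, by simpa using hj⟩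
    rcases hF'.nonneg.eq_or_lt with rfl | ht'
    · obtain ⟨i, hi⟩ := hs hs'
      exact ⟨Sum.inl i, by simpa using hi⟩
    obtain ⟨i, hi⟩ := hs hs'
    obtain ⟨j, hj⟩ := ht ht'
    refine absurd ?_ (hEF i j)
    have : cr (toR (E i)) (toR (F j)) = 0 := by
      rw [hi, hj, cr_smul_left, cr_smul_right, cr_self, mul_zero, mul_zero]
    rw [cr_toR] at this
    exact_mod_cast this

theorem IsToricDiagram.length_le_one {P : Set V} (hP : IsToricDiagram P) {e p : ℤ × ℤ} {t : ℝ}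
    (he : e ≠ 0) (hF : IsFace P (toR e) (toR p) t) : t ≤ 1 := by
  by_contra! ht
  obtain ⟨⟨S, -, hS⟩, -, hfr⟩ := hP
  have hconv : Convex ℝ P := hS ▸ convex_convexHull ℝ _
  have ht0 : t ≠ 0 := by positivity
  have hx : toR (p + e) ∈ openSegment ℝ (toR p) (toR p + t • toR e) := by
    refine ⟨1 - t⁻¹, t⁻¹, sub_pos.2 (inv_lt_one_of_one_lt₀ ht), by positivity, by ring, ?_⟩
    rw [toR_add, smul_add, smul_smul, inv_mul_cancel₀ ht0]
    module
  have hxP : toR (p + e) ∈ P :=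
    hconv.openSegment_subset hF.mem hF.mem_add hx
  have hxf : toR (p + e) ∈ frontier P := by
    refine ⟨subset_closure hxP, fun hint => ?_⟩
    have hcont : Filter.Tendsto
        (fun ε : ℝ => toR (p + e) + ε • ((toR e).2, -(toR e).1)) (nhds 0) (nhds (toR (p + e))) := by
      have : Continuous (fun ε : ℝ => toR (p + e) + ε • ((toR e).2, -(toR e).1)) := by fun_prop
      simpa using this.tendsto 0
    have hev := hcont.eventually (isOpen_interior.mem_nhds hint)
    obtain ⟨δ, hδ, hball⟩ := Metric.eventually_nhds_iff.1 hev
    have hmem := interior_subset (@hball (δ / 2) (by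
      rw [Real.dist_eq, sub_zero, abs_of_pos (by positivity)]; linarith))
    have hle := hF.le _ hmem
    rw [toR_add, cr_add_right, cr_add_right, cr_self, cr_smul_right] at hle
    have hpos : 0 < (toR e).1 ^ 2 + (toR e).2 ^ 2 := by
      rcases (add_nonneg (sq_nonneg (toR e).1) (sq_nonneg (toR e).2)).lt_or_eq with h0 | h0
      · exact h0
      · refine absurd ?_ (toR_ne_zero he)
        ext
        · simp; nlinarith [sq_nonneg (toR e).1, sq_nonneg (toR e).2]
        · simp; nlinarith [sq_nonneg (toR e).1, sq_nonneg (toR e).2]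
    have : cr (toR e) ((toR e).2, -(toR e).1) = -((toR e).1 ^ 2 + (toR e).2 ^ 2) := by
      simp only [cr]; ring
    rw [this] at hle
    nlinarith
  have hext := hfr _ hxf ⟨_, rfl⟩
  have := (mem_extremePoints.1 hext).2 _ hF.mem _ hF.mem_add hx
  rw [toR_add] at this
  exact toR_ne_zero he (by simpa using this.1)

theorem IsLatticePolytope.eq_convexHull {P S : Set V} (hP : IsLatticePolytope P)
    (hS : S.Finite) (h : P.extremePoints ℝ = S) : P = convexHull ℝ S := by
  obtain ⟨T, -, hT⟩ := hP
  have hfin : (toR '' (T : Set (ℤ × ℤ))).Finite := T.finite_toSet.image _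
  have hcomp : IsCompact P := hT ▸ hfin.isCompact_convexHull ℝ
  have hconv : Convex ℝ P := hT ▸ convex_convexHull ℝ _
  have := closure_convexHull_extremePoints hcomp hconv
  rw [h, (hS.isCompact_convexHull ℝ).isClosed.closure_eq] at this
  exact this.symm

theorem exists_bijective_of_sum {X κ : Type*} [Fintype κ] {H : Set V} (hH : IsToricDiagram H)
    {D : X → ℤ × ℤ} (hD : HasEdges H D)
    (hpar : ∀ x y (t : ℝ), 0 < t → toR (D y) = t • toR (D x) → y = x)
    {Ps : κ → Set V} {n : κ → ℕ} {E : ∀ k, Fin (n k) → ℤ × ℤ}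
    (hinj : ∀ k, Function.Injective (E k)) (hE : ∀ k, HasEdges (Ps k) (E k))
    (hsum : H = ∑ k, Ps k) :
    ∃ φ : (Σ k, Fin (n k)) → X, Function.Bijective φ ∧ ∀ p, E p.1 p.2 = D (φ p) := by
  have hface : ∀ k (d : V), ∃ (p : ℤ × ℤ) (t : ℝ), d ≠ 0 → IsFace (Ps k) d (toR p) t ∧
      (0 < t → ∃ i, toR (E k i) = t • d) := by
    intro k d
    by_cases hd : d = 0
    · exact ⟨0, 0, fun h => absurd hd h⟩
    · obtain ⟨p, t, h⟩ := (hE k).face d hd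
      exact ⟨p, t, fun _ => h⟩
  choose p t hface using hface
  have hF : ∀ d : V, d ≠ 0 → IsFace H d (∑ k, toR (p k d)) (∑ k, t k d) := fun d hd =>
    hsum ▸ IsFace.sum Finset.univ (fun k => (hface k d hd).1)
  have hone : ∀ k i, t k (toR (E k i)) = 1 := by
    intro k i
    have h0 := toR_ne_zero ((hE k).ne_zero i)
    obtain ⟨q, hq⟩ := (hE k).edge i
    exact (hface k _ h0).1.length_unique h0 hq
  have htot : ∀ x, ∑ k, t k (toR (D x)) = 1 := by
    intro x
    have h0 := toR_ne_zero (hD.ne_zero x)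
    obtain ⟨q, hq⟩ := hD.edge x
    exact (hF _ h0).length_unique h0 hq
  have hnn : ∀ (d : V), d ≠ 0 → ∀ k, 0 ≤ t k d := fun d hd k => (hface k d hd).1.nonneg
  have hex : ∀ q : Σ k, Fin (n k), ∃ x, E q.1 q.2 = D x := by
    rintro ⟨k, i⟩
    have h0 := toR_ne_zero ((hE k).ne_zero i)
    obtain ⟨q, s, hq, hs⟩ := hD.face _ h0
    have h1 : s ≤ 1 := hH.length_le_one ((hE k).ne_zero i) hq
    have h2 : 1 ≤ s := by
      rw [hq.length_unique h0 (hF _ h0), ← hone k i]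
      exact Finset.single_le_sum (f := fun k' => t k' (toR (E k i)))
        (fun k' _ => hnn _ h0 k') (Finset.mem_univ k)
    obtain rfl : s = 1 := le_antisymm h1 h2
    obtain ⟨x, hx⟩ := hs zero_lt_one
    exact ⟨x, toR_injective (by simpa using hx.symm)⟩
  choose φ hφ using hex
  refine ⟨φ, ⟨?_, ?_⟩, hφ⟩
  · rintro ⟨k, i⟩ ⟨k', i'⟩ h
    have h1 : E k i = D (φ ⟨k, i⟩) := hφ ⟨k, i⟩
    have h2 : E k' i' = D (φ ⟨k, i⟩) := (hφ ⟨k', i'⟩).trans (by rw [h])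
    by_cases hk : k = k'
    · subst hk
      rw [hinj k (h1.trans h2.symm)]
    · exfalso
      classical
      have h3 := htot (φ ⟨k, i⟩)
      have h4 : ∑ j ∈ {k, k'}, t j (toR (D (φ ⟨k, i⟩))) ≤ 1 := h3 ▸
        Finset.sum_le_sum_of_subset_of_nonneg (Finset.subset_univ _)
          (fun j _ _ => hnn _ (toR_ne_zero (hD.ne_zero _)) j)
      rw [Finset.sum_pair hk] at h4
      have h5 := hone k i
      have h6 := hone k' i'
      rw [h1] at h5
      rw [h2] at h6
      linarith
  · intro x
    have h0 := toR_ne_zero (hD.ne_zero x)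
    obtain ⟨k, -, hk⟩ := Finset.exists_ne_zero_of_sum_ne_zero
      (s := Finset.univ) (f := fun k => t k (toR (D x))) (by rw [htot x]; exact one_ne_zero)
    have hk' : 0 < t k (toR (D x)) := lt_of_le_of_ne (hnn _ h0 k) (Ne.symm hk)
    obtain ⟨i, hi⟩ := (hface k _ h0).2 hk'
    refine ⟨⟨k, i⟩, hpar x _ _ hk' ?_⟩
    rw [← hφ ⟨k, i⟩]
    exact hi

theorem range_pair_image (a b : ℤ × ℤ) : toR '' Set.range ![a, b] = {toR a, toR b} := by
  simp [Set.image_insert_eq, Set.pair_comm]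

theorem range_triple_image (a b c : ℤ × ℤ) :
    toR '' Set.range ![a, b, c] = {toR a, toR b, toR c} := by
  simp only [Matrix.range_cons, Matrix.range_empty, Set.union_empty, Set.singleton_union,
    Set.image_insert_eq, Set.image_singleton]

theorem hasEdges_segment {a b : ℤ × ℤ} (hab : a ≠ b) :
    HasEdges (segment ℝ (toR a) (toR b)) (fun i : Fin 2 => ![a, b] (i + 1) - ![a, b] i) := by
  rw [← convexHull_pair, ← range_pair_image]
  refine hasEdges_of_cyclic _ ?_ ?_
  · intro i
    fin_cases i
    · simpa [sub_eq_zero] using hab.symm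
    · simpa [sub_eq_zero] using hab
  · intro i j
    refine ⟨?_, fun _ => (by decide : ∀ i j : Fin 2, j = i ∨ j = i + 1) i j⟩
    fin_cases i <;> fin_cases j <;> simp [crossZ] <;> linarith

theorem affineIndependent_iff_crossZ (a b c : ℤ × ℤ) :
    AffineIndependent ℝ ![toR a, toR b, toR c] ↔ crossZ (b - a) (c - a) ≠ 0 := by
  rw [affineIndependent_iff_not_collinear_set, not_iff_comm, not_not]
  rw [collinear_iff_of_mem (p₀ := toR a) (by simp)]
  constructor
  · intro h
    by_cases hba : b = a
    · refine ⟨toR (c - a), ?_⟩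
      simp only [Set.mem_insert_iff, Set.mem_singleton_iff, forall_eq_or_imp, forall_eq]
      exact ⟨⟨0, by simp⟩, ⟨0, by simp [hba]⟩, ⟨1, by simp [toR_sub]⟩⟩
    · have h' : cr (toR (b - a)) (toR (c - a)) = 0 := by rw [cr_toR, h]; simp
      have := eq_smul_of_cr_eq_zero (toR_ne_zero (sub_ne_zero.2 hba)) h'
      refine ⟨toR (b - a), ?_⟩
      simp only [Set.mem_insert_iff, Set.mem_singleton_iff, forall_eq_or_imp, forall_eq]
      refine ⟨⟨0, by simp⟩, ⟨1, by simp [toR_sub]⟩, ⟨_, sub_eq_iff_eq_add.1 ((toR_sub c a).symm.trans this)⟩⟩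
  · rintro ⟨u, hu⟩
    obtain ⟨r, hr⟩ := hu (toR b) (by simp)
    obtain ⟨s, hs⟩ := hu (toR c) (by simp)
    rw [vadd_eq_add, ← sub_eq_iff_eq_add, ← toR_sub] at hr hs
    have : cr (toR (b - a)) (toR (c - a)) = 0 := by
      rw [hr, hs, cr_smul_left, cr_smul_right, cr_self, mul_zero, mul_zero]
    rw [cr_toR] at this
    exact_mod_cast this

theorem hasEdges_triangle {a b c : ℤ × ℤ} (h : 0 < crossZ (b - a) (c - a)) :
    HasEdges (convexHull ℝ {toR a, toR b, toR c})
      (fun i : Fin 3 => ![a, b, c] (i + 1) - ![a, b, c] i) := by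
  rw [← range_triple_image]
  simp only [crossZ, Prod.fst_sub, Prod.snd_sub] at h
  refine hasEdges_of_cyclic _ ?_ ?_
  · intro i hi
    have h1 := congrArg Prod.fst hi
    have h2 := congrArg Prod.snd hi
    fin_cases i <;> simp [sub_eq_zero] at h1 h2 <;> simp [h1, h2] at h
    linarith
  · intro i j
    constructor
    · fin_cases i <;> fin_cases j <;> simp [crossZ] <;> linarith
    · fin_cases i <;> fin_cases j <;> simp [crossZ] <;> intro h' <;> linarith

theorem IsLatticeTriangle.exists_hasEdges {T : Set V} (hT : IsLatticeTriangle T) :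
    ∃ E : Fin 3 → ℤ × ℤ, Function.Injective E ∧ HasEdges T E ∧ ∑ i, E i = 0 := by
  have key : ∀ a b c : ℤ × ℤ, 0 < crossZ (b - a) (c - a) →
      ∃ E : Fin 3 → ℤ × ℤ, Function.Injective E ∧
        HasEdges (convexHull ℝ {toR a, toR b, toR c}) E ∧ ∑ i, E i = 0 := by
    intro a b c h
    refine ⟨_, ?_, hasEdges_triangle h, ?_⟩
    · simp only [crossZ, Prod.fst_sub, Prod.snd_sub] at h
      have hcr : ∀ i j : Fin 3, i ≠ j → crossZ (![a, b, c] (i + 1) - ![a, b, c] i)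
          (![a, b, c] (j + 1) - ![a, b, c] j) ≠ 0 := by
        intro i j
        fin_cases i <;> fin_cases j <;> simp [crossZ] <;> intro h' <;> linarith
      intro i j hij
      by_contra hne
      apply hcr i j hne
      simp only at hij
      rw [hij]
      simp only [crossZ]; ring
    · simp [Fin.sum_univ_three]
      abel
  obtain ⟨a, b, c, hai, rfl⟩ := hT
  rw [affineIndependent_iff_crossZ] at hai
  rcases hai.lt_or_gt with h | h
  · rw [Set.pair_comm (toR b)]
    apply key
    simp only [crossZ] at h ⊢
    linarith
  · exact key _ _ _ h

theorem convexHull_add_convexHull_subset {S T C : Set V} (hC : Convex ℝ C)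
    (h : ∀ s ∈ S, ∀ t ∈ T, s + t ∈ C) : convexHull ℝ S + convexHull ℝ T ⊆ C := by
  rw [← convexHull_add]
  refine convexHull_min ?_ hC
  rintro _ ⟨s, hs, t, ht, rfl⟩
  exact h s hs t ht

theorem mem_convexHull_pair {S : Set V} {x y : V} (hx : x ∈ S) (hy : y ∈ S) {a b : ℝ}
    (ha : 0 ≤ a) (hb : 0 ≤ b) (hab : a + b = 1) : a • x + b • y ∈ convexHull ℝ S :=
  convex_convexHull ℝ S (subset_convexHull ℝ S hx) (subset_convexHull ℝ S hy) ha hb hab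

theorem mem_convexHull_triple {S : Set V} {x y z : V} (hx : x ∈ S) (hy : y ∈ S) (hz : z ∈ S)
    {a b c : ℝ} (ha : 0 ≤ a) (hb : 0 ≤ b) (hc : 0 ≤ c) (habc : a + b + c = 1) :
    a • x + b • y + c • z ∈ convexHull ℝ S := by
  have := (convex_convexHull ℝ S).sum_mem (t := Finset.univ) (w := ![a, b, c]) (z := ![x, y, z])
    (by intro i _; fin_cases i <;> assumption)
    (by simpa [Fin.sum_univ_three] using habc)
    (by intro i _; fin_cases i <;> apply subset_convexHull ℝ S <;> assumption)
  simpa [Fin.sum_univ_three] using this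

/-- Adding a diagonal to a convex quadrilateral gives the sum of the two triangles into which
the diagonal cuts the quadrilateral. -/
theorem quadrilateral_add_diagonal {p₀ p₁ p₂ p₃ : V}
    (h₀ : 0 < cr (p₁ - p₀) (p₂ - p₁)) (h₁ : 0 < cr (p₂ - p₁) (p₃ - p₂))
    (h₂ : 0 < cr (p₃ - p₂) (p₀ - p₃)) (h₃ : 0 < cr (p₀ - p₃) (p₁ - p₀)) :
    convexHull ℝ {p₀, p₁, p₂, p₃} + convexHull ℝ {p₀, p₂} =
      convexHull ℝ {p₀, p₁, p₂} + convexHull ℝ {p₀, p₂, p₃} := by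
  have mem : ∀ {S : Set V} {x : V}, x ∈ S → x ∈ convexHull ℝ S := fun {S _} h =>
    subset_convexHull ℝ S h
  apply Set.Subset.antisymm
  · apply convexHull_add_convexHull_subset ((convex_convexHull ℝ _).add (convex_convexHull ℝ _))
    have : ∀ x y, x ∈ ({p₀, p₁, p₂} : Set V) → y ∈ ({p₀, p₂, p₃} : Set V) →
        x + y ∈ convexHull ℝ {p₀, p₁, p₂} + convexHull ℝ {p₀, p₂, p₃} := fun x y hx hy =>
      Set.add_mem_add (mem hx) (mem hy)
    rintro s (rfl | rfl | rfl | rfl) t (rfl | rfl)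
    all_goals first
      | (apply this <;> simp; done)
      | (rw [add_comm s t]; apply this <;> simp)
  · apply convexHull_add_convexHull_subset ((convex_convexHull ℝ _).add (convex_convexHull ℝ _))
    have : ∀ x y, x ∈ ({p₀, p₁, p₂, p₃} : Set V) → y ∈ ({p₀, p₂} : Set V) →
        x + y ∈ convexHull ℝ {p₀, p₁, p₂, p₃} + convexHull ℝ {p₀, p₂} := fun x y hx hy =>
      Set.add_mem_add (mem hx) (mem hy)
    have h13 : p₁ + p₃ ∈ convexHull ℝ {p₀, p₁, p₂, p₃} + convexHull ℝ {p₀, p₂} := by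
      set c₀ := cr (p₁ - p₀) (p₂ - p₁) with hc₀
      set c₁ := cr (p₂ - p₁) (p₃ - p₂) with hc₁
      set c₂ := cr (p₃ - p₂) (p₀ - p₃) with hc₂
      set c₃ := cr (p₀ - p₃) (p₁ - p₀) with hc₃
      have hsum : c₀ + c₂ = c₁ + c₃ := by
        rw [hc₀, hc₁, hc₂, hc₃]; simp only [cr, Prod.fst_sub, Prod.snd_sub]; ring
      have hcross : c₁ • p₀ + c₃ • p₂ = c₂ • p₁ + c₀ • p₃ := by
        rw [hc₀, hc₁, hc₂, hc₃]
        ext <;> simp [cr] <;> ring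
      have hpos : 0 < c₁ + c₃ := by positivity
      refine ⟨(c₀ / (c₁ + c₃)) • p₁ + (c₂ / (c₁ + c₃)) • p₃,
        mem_convexHull_pair (by simp) (by simp) (by positivity) (by positivity)
          (by rw [← add_div, hsum, div_self hpos.ne']),
        (c₁ / (c₁ + c₃)) • p₀ + (c₃ / (c₁ + c₃)) • p₂,
        mem_convexHull_pair (by simp) (by simp) (by positivity) (by positivity)
          (by rw [← add_div, div_self hpos.ne']), ?_⟩
      have : (c₁ / (c₁ + c₃)) • p₀ + (c₃ / (c₁ + c₃)) • p₂ =
          (c₂ / (c₁ + c₃)) • p₁ + (c₀ / (c₁ + c₃)) • p₃ := by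
        have := congrArg (fun x => (c₁ + c₃)⁻¹ • x) hcross
        simp only [smul_add, smul_smul] at this
        simpa only [div_eq_inv_mul] using this
      simp only [this]
      have h1 : c₀ / (c₁ + c₃) + c₂ / (c₁ + c₃) = 1 := by
        rw [← add_div, hsum, div_self hpos.ne']
      obtain h2 : c₂ / (c₁ + c₃) = 1 - c₀ / (c₁ + c₃) := by linarith
      rw [h2]; module
    rintro s (rfl | rfl | rfl) t (rfl | rfl | rfl)
    all_goals first
      | exact h13
      | (apply this <;> simp; done)
      | (rw [add_comm s t]; apply this <;> simp)

/-- Adding the sum of two opposite edge vectors to a convex quadrilateral gives a sum of two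
triangles, each with two opposite edges of the quadrilateral. -/
theorem quadrilateral_add_opposite {p₀ p₁ p₂ p₃ : V}
    (h₀ : 0 < cr (p₁ - p₀) (p₂ - p₁)) (h₁ : 0 < cr (p₂ - p₁) (p₃ - p₂))
    (h₂ : 0 < cr (p₃ - p₂) (p₀ - p₃)) (h₃ : 0 < cr (p₀ - p₃) (p₁ - p₀))
    (h₀₂ : 0 < cr (p₁ - p₀) (p₃ - p₂)) (h₁₃ : 0 < cr (p₂ - p₁) (p₀ - p₃)) :
    convexHull ℝ {p₀, p₁, p₂, p₃} + convexHull ℝ {0, p₁ - p₀ + (p₃ - p₂)} =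
      convexHull ℝ {p₀, p₁, p₁ + (p₃ - p₂)} +
        convexHull ℝ {0, p₁ - p₀ + (p₃ - p₂), p₃ - p₀} := by
  have mem : ∀ {S : Set V} {x : V}, x ∈ S → x ∈ convexHull ℝ S := fun {S _} h =>
    subset_convexHull ℝ S h
  apply Set.Subset.antisymm
  · apply convexHull_add_convexHull_subset ((convex_convexHull ℝ _).add (convex_convexHull ℝ _))
    set C := convexHull ℝ {p₀, p₁, p₁ + (p₃ - p₂)} +
        convexHull ℝ {0, p₁ - p₀ + (p₃ - p₂), p₃ - p₀} with hC
    have key : ∀ z x y, x ∈ ({p₀, p₁, p₁ + (p₃ - p₂)} : Set V) →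
        y ∈ ({0, p₁ - p₀ + (p₃ - p₂), p₃ - p₀} : Set V) → z = x + y → z ∈ C := by
      rintro z x y hx hy rfl
      exact Set.add_mem_add (mem hx) (mem hy)
    have h2 : p₂ ∈ C := by
      set c₀₁ := cr (p₁ - p₀) (p₂ - p₁) with hc₀₁
      set c₁₂ := cr (p₂ - p₁) (p₃ - p₂) with hc₁₂
      set c₂₃ := cr (p₃ - p₂) (p₀ - p₃) with hc₂₃
      set c₀₂ := cr (p₁ - p₀) (p₃ - p₂) with hc₀₂
      set c₁₃ := cr (p₂ - p₁) (p₀ - p₃) with hc₁₃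
      have e₁ : c₁₃ = c₀₁ - c₁₂ := by
        rw [hc₀₁, hc₁₂, hc₁₃]; simp only [cr, Prod.fst_sub, Prod.snd_sub]; ring
      have e₂ : c₂₃ = c₀₂ + c₁₂ := by
        rw [hc₀₂, hc₁₂, hc₂₃]; simp only [cr, Prod.fst_sub, Prod.snd_sub]; ring
      rcases le_total (c₀₁ - 2 * c₁₂) c₀₂ with hle | hle
      · refine ⟨((c₂₃ - c₁₃) / c₂₃) • p₁ + (c₁₃ / c₂₃) • (p₁ + (p₃ - p₂)),
          mem_convexHull_pair (by simp) (by simp) (div_nonneg (by linarith) h₂.le) (by positivity)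
            (by field_simp; ring),
          (c₀₂ / c₂₃) • 0 + (c₁₂ / c₂₃) • (p₃ - p₀),
          mem_convexHull_pair (by simp) (by simp) (by positivity) (by positivity)
            (by rw [e₂]; field_simp), ?_⟩
        have hm : ∀ a, c₂₃ * (a / c₂₃) = a := fun a => by field_simp
        apply smul_right_injective V h₂.ne'
        simp only [smul_add, smul_smul, hm]
        rw [hc₁₂, hc₂₃, hc₁₃]
        ext <;> simp [cr] <;> ring
      · refine ⟨((c₁₃ - c₁₂) / c₁₃) • p₀ + (c₁₂ / c₁₃) • (p₁ + (p₃ - p₂)),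
          mem_convexHull_pair (by simp) (by simp) (div_nonneg (by linarith) h₁₃.le) (by positivity)
            (by field_simp; ring),
          (c₀₂ / c₁₃) • (p₁ - p₀ + (p₃ - p₂)) + ((c₁₃ - c₀₂) / c₁₃) • (p₃ - p₀),
          mem_convexHull_pair (by simp) (by simp) (by positivity)
            (div_nonneg (by linarith) h₁₃.le) (by field_simp; ring), ?_⟩
        have hm : ∀ a, c₁₃ * (a / c₁₃) = a := fun a => by field_simp
        apply smul_right_injective V h₁₃.ne'
        simp only [smul_add, smul_smul, hm]
        rw [hc₁₂, hc₀₂, hc₁₃]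
        ext <;> simp [cr] <;> ring
    rintro s (rfl | rfl | rfl | rfl) t (rfl | rfl)
    · exact key _ s 0 (by simp) (by simp) rfl
    · exact key _ s _ (by simp) (by simp) rfl
    · exact key _ s 0 (by simp) (by simp) rfl
    · exact key _ s _ (by simp) (by simp) rfl
    · rwa [add_zero]
    · exact key _ p₁ (p₃ - p₀) (by simp) (by simp) (by abel)
    · exact key _ p₀ (s - p₀) (by simp) (by simp) (by abel)
    · exact key _ (p₁ + (s - p₂)) (s - p₀) (by simp) (by simp) (by abel)
  · apply convexHull_add_convexHull_subset ((convex_convexHull ℝ _).add (convex_convexHull ℝ _))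
    set C := convexHull ℝ {p₀, p₁, p₂, p₃} + convexHull ℝ {0, p₁ - p₀ + (p₃ - p₂)} with hC
    have key : ∀ z x y, x ∈ ({p₀, p₁, p₂, p₃} : Set V) →
        y ∈ ({0, p₁ - p₀ + (p₃ - p₂)} : Set V) → z = x + y → z ∈ C := by
      rintro z x y hx hy rfl
      exact Set.add_mem_add (mem hx) (mem hy)
    have hw : p₁ + (p₃ - p₂) ∈ convexHull ℝ {p₀, p₁, p₂, p₃} := by
      set c₀₁ := cr (p₁ - p₀) (p₂ - p₁) with hc₀₁
      set c₁₂ := cr (p₂ - p₁) (p₃ - p₂) with hc₁₂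
      set c₂₃ := cr (p₃ - p₂) (p₀ - p₃) with hc₂₃
      set c₀₂ := cr (p₁ - p₀) (p₃ - p₂) with hc₀₂
      set c₁₃ := cr (p₂ - p₁) (p₀ - p₃) with hc₁₃
      have e₁ : c₁₃ = c₀₁ - c₁₂ := by
        rw [hc₀₁, hc₁₂, hc₁₃]; simp only [cr, Prod.fst_sub, Prod.snd_sub]; ring
      have e₂ : c₂₃ = c₀₂ + c₁₂ := by
        rw [hc₀₂, hc₁₂, hc₂₃]; simp only [cr, Prod.fst_sub, Prod.snd_sub]; ring
      rcases le_total (c₀₁ - c₁₂) c₀₂ with hle | hle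
      · have hm : ∀ a, c₂₃ * (a / c₂₃) = a := fun a => by field_simp
        have : p₁ + (p₃ - p₂) =
            (c₁₂ / c₂₃) • p₀ + (c₁₃ / c₂₃) • p₂ + ((c₀₂ - c₁₃) / c₂₃) • p₃ := by
          apply smul_right_injective V h₂.ne'
          simp only [smul_add, smul_smul, hm]
          rw [hc₁₂, hc₂₃, hc₁₃, hc₀₂]
          ext <;> simp [cr] <;> ring
        rw [this]
        exact mem_convexHull_triple (by simp) (by simp) (by simp) (by positivity) (by positivity)
          (div_nonneg (by linarith) h₂.le) (by field_simp; linarith)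
      · have hm : ∀ a, c₀₁ * (a / c₀₁) = a := fun a => by field_simp
        have : p₁ + (p₃ - p₂) =
            (c₁₂ / c₀₁) • p₀ + ((c₁₃ - c₀₂) / c₀₁) • p₁ + (c₀₂ / c₀₁) • p₂ := by
          apply smul_right_injective V h₀.ne'
          simp only [smul_add, smul_smul, hm]
          rw [hc₀₁, hc₁₂, hc₁₃, hc₀₂]
          ext <;> simp [cr] <;> ring
        rw [this]
        exact mem_convexHull_triple (by simp) (by simp) (by simp) (by positivity)
          (div_nonneg (by linarith) h₀.le) (by positivity) (by field_simp; linarith)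
    rintro s (rfl | rfl | rfl) t (rfl | rfl | rfl)
    · exact key _ s 0 (by simp) (by simp) rfl
    · exact key _ s _ (by simp) (by simp) rfl
    · exact key _ p₃ 0 (by simp) (by simp) (by abel)
    · exact key _ s 0 (by simp) (by simp) rfl
    · exact key _ s _ (by simp) (by simp) rfl
    · exact key _ p₂ (s - p₀ + (p₃ - p₂)) (by simp) (by simp) (by abel)
    · exact key _ p₀ (p₁ - p₀ + (p₃ - p₂)) (by simp) (by simp) (by abel)
    · exact Set.add_mem_add hw (mem (by simp))
    · exact key _ p₃ (p₁ - p₀ + (p₃ - p₂)) (by simp) (by simp) (by abel)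

/-- `P` is a Minkowski sum of two lattice triangles. -/
def IsSumOfTwoTriangles (P : Set V) : Prop :=
  ∃ T₁ T₂, IsLatticeTriangle T₁ ∧ IsLatticeTriangle T₂ ∧ P = T₁ + T₂

theorem IsLatticeTriangle.translate {T : Set V} (hT : IsLatticeTriangle T) (x : ℤ × ℤ) :
    IsLatticeTriangle ({toR x} + T) := by
  obtain ⟨a, b, c, h, rfl⟩ := hT
  rw [affineIndependent_iff_crossZ] at h
  refine ⟨x + a, x + b, x + c, ?_, ?_⟩
  · rw [affineIndependent_iff_crossZ]
    simpa using h
  · rw [← convexHull_singleton (𝕜 := ℝ) (toR x), ← convexHull_add]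
    simp [Set.image_insert_eq, toR_add]

theorem IsSumOfTwoTriangles.translate {P : Set V} (hP : IsSumOfTwoTriangles P) (x : ℤ × ℤ) :
    IsSumOfTwoTriangles ({toR x} + P) := by
  obtain ⟨T₁, T₂, h₁, h₂, rfl⟩ := hP
  exact ⟨_, T₂, h₁.translate x, h₂, (add_assoc _ _ _).symm⟩

theorem segment_eq_translate (a b : ℤ × ℤ) :
    segment ℝ (toR a) (toR b) = {toR a} + convexHull ℝ {0, toR (b - a)} := by
  rw [← convexHull_singleton (𝕜 := ℝ) (toR a), ← convexHull_add, ← convexHull_pair]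
  simp [Set.image_insert_eq, toR_sub]

theorem add_segment_of_sub_eq {Q : Set V} {a b w : ℤ × ℤ} (hw : b - a = w ∨ b - a = -w)
    (h : IsSumOfTwoTriangles (Q + convexHull ℝ {0, toR w})) :
    IsSumOfTwoTriangles (Q + segment ℝ (toR a) (toR b)) := by
  have key : ∀ a b : ℤ × ℤ, b - a = w →
      IsSumOfTwoTriangles (Q + segment ℝ (toR a) (toR b)) := by
    rintro a b rfl
    rw [segment_eq_translate, add_left_comm]
    exact h.translate a
  rcases hw with hw | hw
  · exact key a b hw
  · rw [segment_symm]
    exact key b a (by rw [← neg_sub, hw, neg_neg])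

theorem isSumOfTwoTriangles_diagonal {p₀ p₁ p₂ p₃ : ℤ × ℤ}
    (h₀ : 0 < crossZ (p₁ - p₀) (p₂ - p₁)) (h₁ : 0 < crossZ (p₂ - p₁) (p₃ - p₂))
    (h₂ : 0 < crossZ (p₃ - p₂) (p₀ - p₃)) (h₃ : 0 < crossZ (p₀ - p₃) (p₁ - p₀)) :
    IsSumOfTwoTriangles (convexHull ℝ {toR p₀, toR p₁, toR p₂, toR p₃} +
      convexHull ℝ {0, toR (p₂ - p₀)}) := by
  have hw : convexHull ℝ {0, toR (p₂ - p₀)} = {toR (-p₀)} + segment ℝ (toR p₀) (toR p₂) := by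
    rw [segment_eq_translate, ← add_assoc]
    simp [toR_neg]
  rw [hw, add_left_comm]
  refine IsSumOfTwoTriangles.translate ?_ _
  refine ⟨_, _, ⟨p₀, p₁, p₂, ?_, rfl⟩, ⟨p₀, p₂, p₃, ?_, rfl⟩, ?_⟩
  · rw [affineIndependent_iff_crossZ]
    refine ne_of_gt ?_
    simp only [crossZ, Prod.fst_sub, Prod.snd_sub] at h₀ ⊢
    linarith
  · rw [affineIndependent_iff_crossZ]
    refine ne_of_gt ?_
    simp only [crossZ, Prod.fst_sub, Prod.snd_sub] at h₂ ⊢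
    linarith
  · rw [← convexHull_pair]
    apply quadrilateral_add_diagonal <;> rw [← toR_sub, ← toR_sub, cr_toR] <;> assumption_mod_cast

theorem isSumOfTwoTriangles_opposite {p₀ p₁ p₂ p₃ : ℤ × ℤ}
    (h₀ : 0 < crossZ (p₁ - p₀) (p₂ - p₁)) (h₁ : 0 < crossZ (p₂ - p₁) (p₃ - p₂))
    (h₂ : 0 < crossZ (p₃ - p₂) (p₀ - p₃)) (h₃ : 0 < crossZ (p₀ - p₃) (p₁ - p₀))
    (h₀₂ : 0 < crossZ (p₁ - p₀) (p₃ - p₂)) (h₁₃ : 0 < crossZ (p₂ - p₁) (p₀ - p₃)) :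
    IsSumOfTwoTriangles (convexHull ℝ {toR p₀, toR p₁, toR p₂, toR p₃} +
      convexHull ℝ {0, toR (p₁ - p₀ + (p₃ - p₂))}) := by
  refine ⟨_, _, ⟨p₀, p₁, p₁ + (p₃ - p₂), ?_, rfl⟩,
    ⟨0, p₁ - p₀ + (p₃ - p₂), p₃ - p₀, ?_, rfl⟩, ?_⟩
  · rw [affineIndependent_iff_crossZ]
    refine ne_of_gt ?_
    simp only [crossZ, Prod.fst_sub, Prod.snd_sub, Prod.fst_add, Prod.snd_add] at h₀₂ ⊢
    linarith
  · rw [affineIndependent_iff_crossZ]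
    refine ne_of_gt ?_
    simp only [crossZ, Prod.fst_sub, Prod.snd_sub, Prod.fst_add, Prod.snd_add, Prod.fst_zero,
      Prod.snd_zero] at h₁₃ ⊢
    linarith
  · simp only [toR_add, toR_sub, toR_zero]
    apply quadrilateral_add_opposite <;> rw [← toR_sub, ← toR_sub, cr_toR] <;> assumption_mod_cast

theorem IsFace.of_smul {P : Set V} {d p : V} {c t : ℝ} (hc : 0 < c)
    (h : IsFace P (c • d) p t) : IsFace P d p (t * c) where
  mem := h.mem
  mem_add := by simpa [smul_smul] using h.mem_add
  nonneg := mul_nonneg h.nonneg hc.le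
  le := by
    intro x hx
    have := h.le x hx
    rw [cr_smul_left, cr_smul_left] at this
    exact le_of_mul_le_mul_left this hc
  eq := by
    intro x hx he
    obtain ⟨s, hs, hs', rfl⟩ := h.eq x hx (by rw [cr_smul_left, cr_smul_left, he])
    exact ⟨s * c, by positivity, by gcongr, by rw [smul_smul]⟩

theorem HasEdges.multiple_le_one {ι : Type*} {P : Set V} (hP : IsToricDiagram P)
    {E : ι → ℤ × ℤ} (hE : HasEdges P E) {i : ι} {g : ℤ} {e : ℤ × ℤ} (hg : 0 < g)
    (h : E i = g • e) : g ≤ 1 := by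
  have he : e ≠ 0 := by
    rintro rfl
    exact hE.ne_zero i (by simpa using h)
  obtain ⟨p, hp⟩ := hE.edge i
  have h' : toR (E i) = (g : ℝ) • toR e := by
    rw [h]; simp [toR]
  rw [h'] at hp
  have := hP.length_le_one he (hp.of_smul (by exact_mod_cast hg))
  rw [one_mul] at this
  exact_mod_cast this

theorem exists_eq_smul_of_crossZ_eq_zero {e f : ℤ × ℤ} (he0 : e ≠ 0)
    (he : ∀ (g : ℤ) (e' : ℤ × ℤ), 0 < g → e = g • e' → g ≤ 1) (hef : crossZ e f = 0) :
    ∃ k : ℤ, f = k • e := by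
  have hg0 : 0 < Int.gcd e.1 e.2 := by
    rw [Int.gcd_pos_iff]
    by_contra! h
    exact he0 (Prod.ext h.1 h.2)
  have hg1 := he (Int.gcd e.1 e.2) (e.1 / Int.gcd e.1 e.2, e.2 / Int.gcd e.1 e.2)
    (by exact_mod_cast hg0) (by
      ext
      · exact (Int.mul_ediv_cancel' (Int.gcd_dvd_left ..)).symm
      · exact (Int.mul_ediv_cancel' (Int.gcd_dvd_right ..)).symm)
  have hg : (Int.gcd e.1 e.2 : ℤ) = 1 := by omega
  have hb := Int.gcd_eq_gcd_ab e.1 e.2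
  rw [hg] at hb
  simp only [crossZ] at hef
  refine ⟨f.1 * Int.gcdA e.1 e.2 + f.2 * Int.gcdB e.1 e.2, ?_⟩
  ext
  · simp only [Prod.smul_fst, smul_eq_mul]
    linear_combination f.1 * hb - Int.gcdB e.1 e.2 * hef
  · simp only [Prod.smul_snd, smul_eq_mul]
    linear_combination f.2 * hb + Int.gcdA e.1 e.2 * hef

theorem hasEdges_quadrilateral {v d : Fin 4 → ℤ × ℤ} (hd : ∀ i, d i = v (i + 1) - v i)
    (hccw : ∀ i, 0 < crossZ (d i) (d (i + 1))) :
    HasEdges (convexHull ℝ (toR '' Set.range v)) d := by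
  obtain rfl : d = fun i => v (i + 1) - v i := funext hd
  refine hasEdges_of_cyclic v ?_ ?_
  · intro i hi
    have := hccw i
    simp only [hi] at this
    simp [crossZ] at this
  · intro i j
    have hj : j = i ∨ j = i + 1 ∨ j = i + 1 + 1 ∨ i = j + 1 := by revert i j; decide
    rcases hj with rfl | rfl | rfl | rfl
    · simp [crossZ]
    · simp [crossZ, mul_comm]
    · have := hccw i
      have h' : crossZ (v (i + 1) - v i) (v (i + 1 + 1) - v i) =
          crossZ (v (i + 1) - v i) (v (i + 1 + 1) - v (i + 1)) := by
        simp only [crossZ, Prod.fst_sub, Prod.snd_sub]; ring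
      rw [h']
      exact ⟨this.le, fun h => absurd h this.ne'⟩
    · have := hccw j
      have h' : crossZ (v (j + 1 + 1) - v (j + 1)) (v j - v (j + 1)) =
          crossZ (v (j + 1) - v j) (v (j + 1 + 1) - v (j + 1)) := by
        simp only [crossZ, Prod.fst_sub, Prod.snd_sub]; ring
      rw [h']
      exact ⟨this.le, fun h => absurd h this.ne'⟩

theorem crossZ_opposite_ne_zero {Q : Set V} (hQ : IsToricDiagram Q) {d : Fin 4 → ℤ × ℤ}
    (hE : HasEdges Q d) (hccw : ∀ i, 0 < crossZ (d i) (d (i + 1))) (i : Fin 4)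
    (hne : d (i + 1 + 1) ≠ -d i) : crossZ (d i) (d (i + 1 + 1)) ≠ 0 := by
  intro h0
  obtain ⟨k, hk⟩ := exists_eq_smul_of_crossZ_eq_zero (hE.ne_zero i)
    (fun g e hg he => hE.multiple_le_one hQ hg he) h0
  have h1 := hccw i
  have h2 := hccw (i + 1)
  have h3 : crossZ (d (i + 1)) (d (i + 1 + 1)) = -k * crossZ (d i) (d (i + 1)) := by
    rw [hk]; simp only [crossZ, Prod.smul_fst, Prod.smul_snd, smul_eq_mul]; ring
  rw [h3] at h2
  have hk0 : 0 < -k := pos_of_mul_pos_left h2 h1.le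
  have hk1 := hE.multiple_le_one hQ hk0 (i := i + 1 + 1) (e := -d i) (by rw [hk]; simp)
  obtain rfl : k = -1 := by omega
  exact hne (by simpa using hk)

theorem crossZ_segment_ne_zero {ι : Type*} {Q : Set V} {E : ι → ℤ × ℤ} (hE : HasEdges Q E)
    {a b : ℤ × ℤ} (hab : a ≠ b) (htd : IsToricDiagram (Q + segment ℝ (toR a) (toR b))) (i : ι) :
    crossZ (E i) (b - a) ≠ 0 := by
  intro h0
  obtain ⟨p, hp⟩ := hE.edge i
  obtain ⟨q, t, hq, -⟩ := (hasEdges_segment hab).face _ (toR_ne_zero (hE.ne_zero i))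
  have hpq := hp.add hq
  rw [← toR_add] at hpq
  have ht := htd.length_le_one (hE.ne_zero i) hpq
  obtain rfl : t = 0 := by linarith [hq.nonneg]
  have hcr : cr (toR (E i)) (toR a) = cr (toR (E i)) (toR b) := by
    have : cr (toR (E i)) (toR (b - a)) = 0 := by rw [cr_toR, h0]; simp
    rw [toR_sub, cr_sub_right] at this
    linarith
  have hqa : cr (toR (E i)) (toR q) = cr (toR (E i)) (toR a) := by
    obtain ⟨α, β, -, -, hαβ, hq'⟩ := hq.mem
    rw [← hq', cr_add_right, cr_smul_right, cr_smul_right, ← hcr, ← add_mul, hαβ, one_mul]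
  obtain ⟨s, hs, hs', h1⟩ := hq.eq _ (left_mem_segment ℝ _ _) hqa.symm
  obtain ⟨r, hr, hr', h2⟩ := hq.eq _ (right_mem_segment ℝ _ _) (hcr.symm.trans hqa.symm)
  obtain rfl : s = 0 := le_antisymm hs' hs
  obtain rfl : r = 0 := le_antisymm hr' hr
  exact hab (toR_injective (h1.trans h2.symm))

theorem exists_hasEdges_of_summand {P : Set V} (hP : IsLatticeSegment P ∨ IsLatticeTriangle P) :
    ∃ (n : ℕ) (E : Fin n → ℤ × ℤ), Function.Injective E ∧ HasEdges P E ∧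
      ((n = 2 ∧ ∃ i j, E i = -E j) ∨ (n = 3 ∧ IsLatticeTriangle P ∧
        ∀ i, ∃ j k, i ≠ j ∧ i ≠ k ∧ j ≠ k ∧ E i + E j + E k = 0)) := by
  rcases hP with ⟨a, b, hab, rfl⟩ | hT
  · refine ⟨2, _, ?_, hasEdges_segment hab, Or.inl ⟨rfl, 0, 1, by simp⟩⟩
    have hne : b - a ≠ a - b := fun h => hab (by
      have h1 := congrArg Prod.fst h
      have h2 := congrArg Prod.snd h
      simp only [Prod.fst_sub, Prod.snd_sub] at h1 h2
      ext <;> omega)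
    intro i j hij
    fin_cases i <;> fin_cases j <;> simp at hij ⊢
    · exact hne hij
    · exact hne hij.symm
  · obtain ⟨E, hinj, hE, hsum⟩ := hT.exists_hasEdges
    refine ⟨3, E, hinj, hE, Or.inr ⟨rfl, hT, fun i => ⟨i + 1, i + 2, ?_, ?_, ?_, ?_⟩⟩⟩
    · revert i; decide
    · revert i; decide
    · revert i; decide
    · rw [Fin.sum_univ_three] at hsum
      fin_cases i
      · exact hsum
      · rw [← hsum]; simp; abel
      · rw [← hsum]; simp; abel

theorem image_range_eq_cyclic (v : Fin 4 → ℤ × ℤ) (i : Fin 4) :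
    toR '' Set.range v =
      {toR (v i), toR (v (i + 1)), toR (v (i + 1 + 1)), toR (v (i + 1 + 1 + 1))} := by
  have h : Set.range v = {v i, v (i + 1), v (i + 1 + 1), v (i + 1 + 1 + 1)} := by
    apply Set.Subset.antisymm
    · rintro _ ⟨j, rfl⟩
      have hj : j = i ∨ j = i + 1 ∨ j = i + 1 + 1 ∨ j = i + 1 + 1 + 1 := by
        revert i j; decide
      rcases hj with rfl | rfl | rfl | rfl <;> simp
    · rintro _ (rfl | rfl | rfl | rfl) <;> exact Set.mem_range_self _
  rw [h]
  simp [Set.image_insert_eq]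

theorem isSumOfTwoTriangles_adjacent {v d : Fin 4 → ℤ × ℤ} (hd : ∀ i, d i = v (i + 1) - v i)
    (hccw : ∀ i, 0 < crossZ (d i) (d (i + 1))) (i : Fin 4) :
    IsSumOfTwoTriangles (convexHull ℝ (toR '' Set.range v) +
      convexHull ℝ {0, toR (d i + d (i + 1))}) := by
  have h4 : i + 1 + 1 + 1 + 1 = i := by revert i; decide
  have h₃ := hccw (i + 1 + 1 + 1)
  rw [h4] at h₃
  have hw : d i + d (i + 1) = v (i + 1 + 1) - v i := by rw [hd, hd]; abel
  rw [image_range_eq_cyclic v i, hw]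
  refine isSumOfTwoTriangles_diagonal ?_ ?_ ?_ ?_
  · simpa only [hd] using hccw i
  · simpa only [hd] using hccw (i + 1)
  · simpa only [hd, h4] using hccw (i + 1 + 1)
  · simpa only [hd, h4] using h₃

theorem isSumOfTwoTriangles_opposite_of_pos {v d : Fin 4 → ℤ × ℤ}
    (hd : ∀ i, d i = v (i + 1) - v i) (hccw : ∀ i, 0 < crossZ (d i) (d (i + 1))) (i : Fin 4)
    (h : 0 < crossZ (d i) (d (i + 1 + 1)))
    (h' : 0 < crossZ (d (i + 1)) (d (i + 1 + 1 + 1))) :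
    IsSumOfTwoTriangles (convexHull ℝ (toR '' Set.range v) +
      convexHull ℝ {0, toR (d i + d (i + 1 + 1))}) := by
  have h4 : i + 1 + 1 + 1 + 1 = i := by clear h h'; revert i; decide
  have h₃ := hccw (i + 1 + 1 + 1)
  rw [h4] at h₃
  rw [image_range_eq_cyclic v i, hd i, hd (i + 1 + 1)]
  refine isSumOfTwoTriangles_opposite ?_ ?_ ?_ ?_ ?_ ?_
  · simpa only [hd] using hccw i
  · simpa only [hd] using hccw (i + 1)
  · simpa only [hd, h4] using hccw (i + 1 + 1)
  · simpa only [hd, h4] using h₃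
  · simpa only [hd] using h
  · simpa only [hd, h4] using h'

theorem crossZ_swap (u w : ℤ × ℤ) : crossZ u w = -crossZ w u := by
  simp only [crossZ]; ring

theorem sum_edges_eq_zero {v d : Fin 4 → ℤ × ℤ} (hd : ∀ i, d i = v (i + 1) - v i) :
    d 0 + d 1 + d 2 + d 3 = 0 := by
  rw [hd, hd, hd, hd]
  change v 1 - v 0 + (v 2 - v 1) + (v 3 - v 2) + (v 0 - v 3) = 0
  abel

/-- If `w` is plus or minus a sum of two edge vectors of a quadrilateral without parallel edges,
then the sum of the quadrilateral and the segment from `0` to `w` is a sum of two triangles. -/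
theorem isSumOfTwoTriangles_of_add_edges {v d : Fin 4 → ℤ × ℤ}
    (hd : ∀ i, d i = v (i + 1) - v i) (hccw : ∀ i, 0 < crossZ (d i) (d (i + 1)))
    (hopp : ∀ i, crossZ (d i) (d (i + 1 + 1)) ≠ 0) {a b : ℤ × ℤ} {i j : Fin 4} (hij : i < j)
    (hw : d i + d j = b - a ∨ d i + d j = -(b - a)) :
    IsSumOfTwoTriangles (convexHull ℝ (toR '' Set.range v) + segment ℝ (toR a) (toR b)) := by
  have hsum := sum_edges_eq_zero hd
  have key : ∀ w, IsSumOfTwoTriangles (convexHull ℝ (toR '' Set.range v) +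
      convexHull ℝ {0, toR w}) → (d i + d j = w ∨ d i + d j = -w) →
      IsSumOfTwoTriangles (convexHull ℝ (toR '' Set.range v) + segment ℝ (toR a) (toR b)) := by
    intro w h hw'
    refine add_segment_of_sub_eq ?_ h
    rcases hw with hw | hw <;> rcases hw' with hw' | hw' <;> rw [hw] at hw'
    · exact Or.inl hw'
    · exact Or.inr hw'
    · exact Or.inr (neg_eq_iff_eq_neg.mp hw')
    · exact Or.inl (neg_injective hw')
  have adj := isSumOfTwoTriangles_adjacent hd hccw
  have hneg : ∀ {x y z t : ℤ × ℤ}, x + y + z + t = 0 → z + t = -(x + y) := fun h => by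
    rw [eq_neg_iff_add_eq_zero, ← h]; abel
  have opp : (d i + d j = d 0 + d 2 ∨ d i + d j = -(d 0 + d 2)) →
      IsSumOfTwoTriangles (convexHull ℝ (toR '' Set.range v) + segment ℝ (toR a) (toR b)) := by
    intro h
    have pos := isSumOfTwoTriangles_opposite_of_pos hd hccw
    have h13 : d 1 + d 3 = -(d 0 + d 2) := hneg (by rw [← hsum]; abel)
    have h' : d i + d j = d 1 + d 3 ∨ d i + d j = -(d 1 + d 3) := by
      rw [h13, neg_neg]; exact h.symm
    rcases lt_or_gt_of_ne (hopp 0) with h02 | h02 <;>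
      rcases lt_or_gt_of_ne (hopp 1) with h13 | h13 <;>
      simp only [show (0 : Fin 4) + 1 = 1 from rfl, show (1 : Fin 4) + 1 = 2 from rfl,
        show (2 : Fin 4) + 1 = 3 from rfl] at h02 h13
    · rw [crossZ_swap] at h02 h13
      refine key _ (pos 2 (neg_neg_iff_pos.mp h02) (neg_neg_iff_pos.mp h13)) ?_
      rw [add_comm (d 0)] at h
      exact h
    · rw [crossZ_swap] at h02
      exact key _ (pos 1 h13 (neg_neg_iff_pos.mp h02)) h'
    · rw [crossZ_swap] at h13
      refine key _ (pos 3 (neg_neg_iff_pos.mp h13) h02) ?_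
      rw [add_comm (d 1)] at h'
      exact h'
    · exact key _ (pos 0 h02 h13) h
  have hcases : (i = 0 ∧ j = 1) ∨ (i = 0 ∧ j = 2) ∨ (i = 0 ∧ j = 3) ∨ (i = 1 ∧ j = 2) ∨
      (i = 1 ∧ j = 3) ∨ (i = 2 ∧ j = 3) := by
    clear key opp hw; revert i j; decide
  rcases hcases with ⟨rfl, rfl⟩ | ⟨rfl, rfl⟩ | ⟨rfl, rfl⟩ | ⟨rfl, rfl⟩ | ⟨rfl, rfl⟩ | ⟨rfl, rfl⟩
  · exact key _ (adj 0) (Or.inl rfl)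
  · exact opp (Or.inl rfl)
  · exact key _ (adj 3) (Or.inl (add_comm _ _))
  · exact key _ (adj 1) (Or.inl rfl)
  · exact opp (Or.inr (hneg (by rw [← hsum]; abel)))
  · exact key _ (adj 2) (Or.inl rfl)

theorem IsSumOfTwoTriangles.hasLatticeMaximalDecomposition {P : Set V}
    (hP : IsSumOfTwoTriangles P) : HasLatticeMaximalDecomposition P := by
  obtain ⟨T₁, T₂, h₁, h₂, rfl⟩ := hP
  refine ⟨1, ![T₁, T₂], le_rfl, by simp [Fin.sum_univ_two], fun k => Or.inr ?_⟩
  fin_cases k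
  · exact h₁
  · exact h₂

/-- If a toric diagram has four edge vectors `d` together with `w` and `-w`, no two of them
parallel except `±w`, then each of its decompositions into lattice segments and triangles
consists of two triangles, and `±w` is a sum of two of the `d i`. -/
theorem maximal_decomposition {H : Set V} (hH : IsToricDiagram H) {d : Fin 4 → ℤ × ℤ}
    {w : ℤ × ℤ} (hD : HasEdges H (Sum.elim d ![w, -w]))
    (hd : ∀ i j, i ≠ j → crossZ (d i) (d j) ≠ 0) (hdw : ∀ i, crossZ (d i) w ≠ 0)
    {m : ℕ} {Ps : Fin (m + 1) → Set V} (hsum : H = ∑ k, Ps k)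
    (hPs : ∀ k, IsLatticeSegment (Ps k) ∨ IsLatticeTriangle (Ps k)) :
    (m = 1 ∧ ∀ k, IsLatticeTriangle (Ps k)) ∧ ∃ i j, i ≠ j ∧ d i + d j = -w := by
  set D : Fin 4 ⊕ Fin 2 → ℤ × ℤ := Sum.elim d ![w, -w] with hDdef
  have hcross : ∀ x y, x ≠ y → crossZ (D x) (D y) = 0 →
      D x = -D y ∧ (x = Sum.inr 0 ∨ y = Sum.inr 0) := by
    rintro (i | i) (j | j) hxy h0
    · exact absurd h0 (hd i j (by simpa using hxy))
    · refine absurd h0 ?_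
      have := hdw i
      fin_cases j
      · exact this
      · simp only [hDdef, crossZ] at this ⊢
        simp; omega
    · refine absurd h0 ?_
      have := hdw j
      fin_cases i
      · simp only [hDdef, crossZ] at this ⊢
        simp; intro h; exact this (by linarith)
      · simp only [hDdef, crossZ] at this ⊢
        simp; intro h; exact this (by linarith)
    · fin_cases i <;> fin_cases j <;> simp [hDdef] at hxy ⊢
  have hpar : ∀ x y (t : ℝ), 0 < t → toR (D y) = t • toR (D x) → y = x := by
    intro x y t ht h
    by_contra hne
    have h0 : crossZ (D x) (D y) = 0 := by
      have : cr (toR (D x)) (toR (D y)) = 0 := by rw [h, cr_smul_right, cr_self, mul_zero]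
      rw [cr_toR] at this
      exact_mod_cast this
    have h1 := (hcross x y (Ne.symm hne) h0).1
    rw [h1, toR_neg, smul_neg] at h
    have h2 : (1 + t) • toR (D y) = 0 := by
      rw [add_smul, one_smul]; nth_rewrite 1 [h]; simp
    rcases smul_eq_zero.mp h2 with h3 | h3
    · linarith
    · exact toR_ne_zero (hD.ne_zero y) h3
  choose n E hinj hE hcase using fun k => exists_hasEdges_of_summand (hPs k)
  obtain ⟨φ, hφ, hφE⟩ := exists_bijective_of_sum hH hD hpar hinj hE hsum
  have hcard : ∑ k, n k = 6 := by
    have := Fintype.card_of_bijective hφ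
    simpa using this
  have hseg : ∀ k, n k = 2 → ∃ i, φ ⟨k, i⟩ = Sum.inr 0 := by
    intro k hk
    rcases hcase k with ⟨-, i, j, hij⟩ | ⟨h3, -⟩
    · have hne : i ≠ j := by
        rintro rfl
        exact (hE k).ne_zero i (self_eq_neg.mp hij)
      have hne' : φ ⟨k, i⟩ ≠ φ ⟨k, j⟩ := fun h => hne (by simpa using hφ.1 h)
      have h0 : crossZ (D (φ ⟨k, i⟩)) (D (φ ⟨k, j⟩)) = 0 := by
        rw [← hφE, ← hφE]
        simp only [hij, crossZ, Prod.fst_neg, Prod.snd_neg]; ring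
      rcases (hcross _ _ hne' h0).2 with h | h
      · exact ⟨i, h⟩
      · exact ⟨j, h⟩
    · omega
  have hcount : (Finset.univ.filter fun k => n k = 2).card ≤ 1 := by
    rw [Finset.card_le_one]
    intro k hk l hl
    obtain ⟨i, hi⟩ := hseg k (by simpa using hk)
    obtain ⟨j, hj⟩ := hseg l (by simpa using hl)
    exact congrArg Sigma.fst (hφ.1 (hi.trans hj.symm))
  have hn : ∀ k, n k + (if n k = 2 then 1 else 0) = 3 := by
    intro k
    rcases hcase k with ⟨h, -⟩ | ⟨h, -⟩ <;> simp [h]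
  have htotal : 6 + (Finset.univ.filter fun k => n k = 2).card = 3 * (m + 1) := by
    rw [Finset.card_filter, ← hcard, ← Finset.sum_add_distrib, Finset.sum_congr rfl fun k _ => hn k]
    simp [mul_comm]
  have hzero : (Finset.univ.filter fun k => n k = 2).card = 0 := by omega
  have hn2 : ∀ k, n k ≠ 2 := by
    intro k hk
    rw [Finset.card_eq_zero, Finset.filter_eq_empty_iff] at hzero
    exact hzero (Finset.mem_univ k) hk
  have htri : ∀ k, n k = 3 ∧ IsLatticeTriangle (Ps k) ∧
      ∀ i, ∃ j l, i ≠ j ∧ i ≠ l ∧ j ≠ l ∧ E k i + E k j + E k l = 0 := fun k =>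
    (hcase k).resolve_left fun h => hn2 k h.1
  refine ⟨⟨by omega, fun k => (htri k).2.1⟩, ?_⟩
  obtain ⟨⟨k, i⟩, hki⟩ := hφ.2 (Sum.inr 0)
  obtain ⟨j, l, hij, hil, hjl, h0⟩ := (htri k).2.2 i
  have hinr : ∀ j l, i ≠ j → i ≠ l → E k i + E k j + E k l = 0 → ∃ x, φ ⟨k, j⟩ = Sum.inl x := by
    intro j l hij hil h0
    rcases hx : φ ⟨k, j⟩ with x | x
    · exact ⟨x, rfl⟩
    · exfalso
      have hx' : x = 0 ∨ x = 1 := by clear * -; revert x; decide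
      rcases hx' with rfl | rfl
      · exact hij (by simpa using hφ.1 (hki.trans hx.symm))
      · have e1 := hφE ⟨k, i⟩
        have e2 := hφE ⟨k, j⟩
        rw [hki] at e1
        rw [hx] at e2
        simp only [hDdef, Sum.elim_inr] at e1 e2
        rw [e1, e2] at h0
        exact (hE k).ne_zero l (by simpa using h0)
  obtain ⟨x, hx⟩ := hinr j l hij hil h0
  obtain ⟨y, hy⟩ := hinr l j hil hij (by rw [← h0]; abel)
  refine ⟨x, y, ?_, ?_⟩
  · rintro rfl
    exact hjl (by simpa using hφ.1 (hx.trans hy.symm))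
  · have e1 := hφE ⟨k, i⟩
    have e2 := hφE ⟨k, j⟩
    have e3 := hφE ⟨k, l⟩
    rw [hki] at e1
    rw [hx] at e2
    rw [hy] at e3
    simp only [hDdef, Sum.elim_inr, Sum.elim_inl] at e1 e2 e3
    rw [e1, e2, e3] at h0
    rw [eq_neg_iff_add_eq_zero, ← h0]
    simp; abel

/-- Let `Q` be a toric diagram with exactly four extreme points, not a
parallelogram, with oriented (counterclockwise) edge vectors `d 0, d 1, d 2, d 3`, and let
`L` be a lattice segment with edge vector `b - a` such that `Q + L` is a toric diagram.
Then `Q + L` admits a lattice maximal Minkowski decomposition iff `d i + d j = ±(b - a)`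
for some `i < j`, in which case every lattice maximal Minkowski decomposition of `Q + L`
is a Minkowski sum of exactly two lattice triangles. -/
theorem statement1 (Q : Set V) (hQ : IsToricDiagram Q)
    (v : Fin 4 → ℤ × ℤ) (hvinj : Function.Injective v)
    (hext : Q.extremePoints ℝ = toR '' Set.range v)
    (d : Fin 4 → ℤ × ℤ) (hd : ∀ i, d i = v (i + 1) - v i)
    (hccw : ∀ i, 0 < crossZ (d i) (d (i + 1)))
    (hnotpar : v 0 + v 2 ≠ v 1 + v 3)
    (a b : ℤ × ℤ) (hab : a ≠ b)
    (htd : IsToricDiagram (Q + segment ℝ (toR a) (toR b))) :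
    (HasLatticeMaximalDecomposition (Q + segment ℝ (toR a) (toR b)) ↔
      ∃ i j : Fin 4, i < j ∧ (d i + d j = b - a ∨ d i + d j = -(b - a))) ∧
    ((∃ i j : Fin 4, i < j ∧ (d i + d j = b - a ∨ d i + d j = -(b - a))) →
      ∀ (m : ℕ) (Ps : Fin (m + 1) → Set V), 1 ≤ m →
        Q + segment ℝ (toR a) (toR b) = ∑ k, Ps k →
        (∀ k, IsLatticeSegment (Ps k) ∨ IsLatticeTriangle (Ps k)) →
        m = 1 ∧ ∀ k, IsLatticeTriangle (Ps k)) := by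
  have hQ' : Q = convexHull ℝ (toR '' Set.range v) :=
    hQ.1.eq_convexHull ((Set.finite_range v).image toR) hext
  have hE : HasEdges Q d := hQ' ▸ hasEdges_quadrilateral hd hccw
  have hopp : ∀ i, crossZ (d i) (d (i + 1 + 1)) ≠ 0 := by
    intro i
    refine crossZ_opposite_ne_zero hQ hE hccw i fun h => hnotpar ?_
    rw [hd, hd] at h
    fin_cases i
    · change v 3 - v 2 = -(v 1 - v 0) at h
      linear_combination -h
    · change v 0 - v 3 = -(v 2 - v 1) at h
      linear_combination h
    · change v 1 - v 0 = -(v 3 - v 2) at h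
      linear_combination -h
    · change v 2 - v 1 = -(v 0 - v 3) at h
      linear_combination h
  have hcross : ∀ i j, i ≠ j → crossZ (d i) (d j) ≠ 0 := by
    intro i j hij
    have hj : j = i + 1 ∨ j = i + 1 + 1 ∨ i = j + 1 := by clear * - hij; revert i j; decide
    rcases hj with rfl | rfl | rfl
    · exact (hccw i).ne'
    · exact hopp i
    · rw [crossZ_swap]
      exact neg_ne_zero.mpr (hccw j).ne'
  have hdw := crossZ_segment_ne_zero hE hab htd
  have hD : HasEdges (Q + segment ℝ (toR a) (toR b)) (Sum.elim d ![b - a, -(b - a)]) := by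
    have hF : (fun i : Fin 2 => ![a, b] (i + 1) - ![a, b] i) = ![b - a, -(b - a)] := by
      funext i
      fin_cases i <;> simp
    have hL := hasEdges_segment hab
    rw [hF] at hL
    refine hE.add hL fun i j => ?_
    fin_cases j
    · exact hdw i
    · have := hdw i
      simp only [crossZ] at this ⊢
      intro h
      apply this
      simp at h ⊢
      linarith
  refine ⟨⟨?_, ?_⟩, ?_⟩
  · rintro ⟨m, Ps, -, hsum, hPs⟩
    obtain ⟨-, i, j, hij, h⟩ := maximal_decomposition htd hD hcross hdw hsum hPs
    rcases lt_or_gt_of_ne hij with hlt | hlt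
    · exact ⟨i, j, hlt, Or.inr h⟩
    · exact ⟨j, i, hlt, Or.inr (by rw [add_comm, h])⟩
  · rintro ⟨i, j, hij, hw⟩
    rw [hQ']
    exact (isSumOfTwoTriangles_of_add_edges hd hccw hopp hij hw).hasLatticeMaximalDecomposition
  · intro _ m Ps _ hsum hPs
    exact (maximal_decomposition htd hD hcross hdw hsum hPs).1
end
end

section
/- A toric diagram P ⊂ ℝ² with exactly four extreme points admits a Minkowski decomposition P = A + B into two lattice polytopes neither of which is a single point if and only if P is a parallelogram; and in that case A and B are necessarily lattice segments (translates of the two edges of P). -/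
open Set Pointwise

noncomputable section

/-- The signed area (doubled) of the triangle `a b c`. -/
def signedArea (a b c : V) : ℝ := (b.1 - a.1) * (c.2 - a.2) - (b.2 - a.2) * (c.1 - a.1)

lemma IsLatticePolytope.convex {P : Set V} (hP : IsLatticePolytope P) : Convex ℝ P := by
  obtain ⟨S, -, rfl⟩ := hP
  exact convex_convexHull ℝ _

lemma IsLatticePolytope.isCompact {P : Set V} (hP : IsLatticePolytope P) : IsCompact P := by
  obtain ⟨S, -, rfl⟩ := hP
  exact (S.finite_toSet.image toR).isCompact_convexHull ℝ

lemma IsLatticePolytope.nonempty {P : Set V} (hP : IsLatticePolytope P) : P.Nonempty := by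
  obtain ⟨S, hS, rfl⟩ := hP
  exact (hS.to_set.image toR).convexHull

lemma IsLatticePolytope.extremePoints_subset {P : Set V} (hP : IsLatticePolytope P) :
    P.extremePoints ℝ ⊆ latticePoints := by
  obtain ⟨S, -, rfl⟩ := hP
  exact extremePoints_convexHull_subset.trans (image_subset_range _ _)

lemma IsLatticePolytope.convexHull_extremePoints {P : Set V} (hP : IsLatticePolytope P)
    (hfin : (P.extremePoints ℝ).Finite) : convexHull ℝ (P.extremePoints ℝ) = P := by
  rw [← (hfin.isClosed_convexHull ℝ).closure_eq]
  exact closure_convexHull_extremePoints hP.isCompact hP.convex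

lemma toR_add_s3 (a b : ℤ × ℤ) : toR (a + b) = toR a + toR b := by
  simp [toR]

lemma add_mem_latticePoints {x y : V} (hx : x ∈ latticePoints) (hy : y ∈ latticePoints) :
    x + y ∈ latticePoints := by
  obtain ⟨a, rfl⟩ := hx
  obtain ⟨b, rfl⟩ := hy
  exact ⟨a + b, toR_add_s3 a b⟩

lemma isLatticePolytope_segment {a b : V} (ha : a ∈ latticePoints) (hb : b ∈ latticePoints) :
    IsLatticePolytope (segment ℝ a b) := by
  obtain ⟨a, rfl⟩ := ha
  obtain ⟨b, rfl⟩ := hb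
  refine ⟨{a, b}, by simp, ?_⟩
  rw [← convexHull_pair]
  congr 1
  simp [image_pair]

lemma segment_ne_singleton {a b : V} (hab : a ≠ b) : ¬ ∃ x, segment ℝ a b = {x} := by
  rintro ⟨x, hx⟩
  have h1 : a ∈ ({x} : Set V) := hx ▸ left_mem_segment ℝ a b
  have h2 : b ∈ ({x} : Set V) := hx ▸ right_mem_segment ℝ a b
  exact hab (h1.trans h2.symm)

/-- An extreme point of a Minkowski sum is a sum of extreme points. -/
lemma exists_extremePoints_add {A B : Set V} {v : V} (hv : v ∈ (A + B).extremePoints ℝ) :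
    ∃ a ∈ A.extremePoints ℝ, ∃ b ∈ B.extremePoints ℝ, a + b = v := by
  obtain ⟨⟨a, ha, b, hb, rfl⟩, h⟩ := hv
  refine ⟨a, ⟨ha, ?_⟩, b, ⟨hb, ?_⟩, rfl⟩
  · rintro x hx y hy ⟨s, t, hs, ht, hst, rfl⟩
    have := h (add_mem_add hx hb) (add_mem_add hy hb) ⟨s, t, hs, ht, hst, by
      rw [smul_add, smul_add, add_add_add_comm, ← add_smul, hst, one_smul]⟩
    simpa using this
  · rintro x hx y hy ⟨s, t, hs, ht, hst, rfl⟩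
    have := h (add_mem_add ha hx) (add_mem_add ha hy) ⟨s, t, hs, ht, hst, by
      rw [smul_add, smul_add, add_add_add_comm, ← add_smul, hst, one_smul]⟩
    simpa using this

/-- Cancellation for Minkowski sums. -/
lemma subset_of_add_subset_add {A A' B : Set V} (hA' : Convex ℝ A') (hcA' : IsClosed A')
    (hB : IsCompact B) (hneB : B.Nonempty) (h : A + B ⊆ A' + B) : A ⊆ A' := by
  intro a ha
  by_contra hna
  obtain ⟨f, u, hfu, hua⟩ := geometric_hahn_banach_closed_point hA' hcA' hna
  obtain ⟨b, hb, hmax⟩ := hB.exists_isMaxOn hneB f.continuous.continuousOn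
  obtain ⟨a', ha', b', hb', hab⟩ := h (add_mem_add ha hb)
  have h1 := hfu a' ha'
  have h2 : f b' ≤ f b := hmax hb'
  have h3 : f a' + f b' = f a + f b := by rw [← map_add, ← map_add, ← hab]
  linarith

/-- The summands of a polytope are spanned by the components of its vertices. -/
lemma eq_convexHull_of_add {A B S T : Set V} (hA : IsLatticePolytope A)
    (hB : IsLatticePolytope B) (hS : S.Finite) (hSA : S ⊆ A) (hTB : T ⊆ B)
    (h : A + B ⊆ convexHull ℝ (S + T)) : A = convexHull ℝ S := by
  refine Subset.antisymm ?_ (convexHull_min hSA hA.convex)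
  refine subset_of_add_subset_add (convex_convexHull ℝ S) (hS.isClosed_convexHull ℝ)
    hB.isCompact hB.nonempty (h.trans ?_)
  rw [convexHull_add]
  exact add_subset_add_left (convexHull_min hTB hB.convex)

lemma convex_signedArea_nonneg (a b : V) : Convex ℝ {x | 0 ≤ signedArea a b x} := by
  intro x hx y hy s t hs ht hst
  simp only [mem_ofPred_eq, signedArea] at *
  obtain rfl : s = 1 - t := by linarith
  have h1 := mul_nonneg hs hx
  have h2 := mul_nonneg ht hy
  simp only [Prod.fst_add, Prod.snd_add, Prod.smul_fst, Prod.smul_snd, smul_eq_mul]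
  linarith

/-- A point of `P` on a supporting line of `P` lies on the frontier. -/
lemma mem_frontier_of_signedArea {P : Set V} {a b x : V} (hab : a ≠ b)
    (hP : ∀ y ∈ P, 0 ≤ signedArea a b y) (hx : x ∈ P) (h0 : signedArea a b x = 0) :
    x ∈ frontier P := by
  refine ⟨subset_closure hx, fun hxi => ?_⟩
  have hc : Continuous fun t : ℝ => x + t • ((b.2 - a.2, -(b.1 - a.1)) : V) := by fun_prop
  have hn : ∀ᶠ t in nhds (0 : ℝ), x + t • ((b.2 - a.2, -(b.1 - a.1)) : V) ∈ P := by
    apply hc.continuousAt.eventually_mem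
    simpa using mem_interior_iff_mem_nhds.1 hxi
  obtain ⟨t, htP, ht⟩ :=
    ((hn.filter_mono nhdsWithin_le_nhds).and (self_mem_nhdsWithin (s := Ioi (0 : ℝ)))).exists
  have h1 := hP _ htP
  have hpos : 0 < (b.1 - a.1) ^ 2 + (b.2 - a.2) ^ 2 := by
    by_contra hle
    apply hab
    ext <;> nlinarith [sq_nonneg (b.1 - a.1), sq_nonneg (b.2 - a.2)]
  have h2 : 0 < t * ((b.1 - a.1) ^ 2 + (b.2 - a.2) ^ 2) := mul_pos ht hpos
  simp only [signedArea, Prod.fst_add, Prod.snd_add, Prod.smul_fst, Prod.smul_snd,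
    smul_eq_mul] at h0 h1
  linarith

lemma mem_convexHull_of_signedArea {a b c x : V} (h : 0 < signedArea a b c)
    (h1 : 0 ≤ signedArea x b c) (h2 : 0 ≤ signedArea a x c) (h3 : 0 ≤ signedArea a b x) :
    x ∈ convexHull ℝ {a, b, c} := by
  have hsum : signedArea x b c + signedArea a x c + signedArea a b x = signedArea a b c := by
    simp only [signedArea]; ring
  have e : x = (signedArea x b c / signedArea a b c) • a +
      (signedArea a x c / signedArea a b c) • b + (signedArea a b x / signedArea a b c) • c := by
    ext <;> simp only [Prod.fst_add, Prod.snd_add, Prod.smul_fst, Prod.smul_snd,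
      smul_eq_mul] <;> field_simp <;> simp only [signedArea] <;> ring
  rw [e]
  have := (convex_convexHull ℝ {a, b, c}).sum_mem (t := Finset.univ)
    (w := ![signedArea x b c / signedArea a b c, signedArea a x c / signedArea a b c,
      signedArea a b x / signedArea a b c]) (z := ![a, b, c])
    (by intro i _; fin_cases i <;> simp <;> positivity)
    (by simp [Fin.sum_univ_three, ← add_div, hsum, h.ne'])
    (by intro i _; apply subset_convexHull; fin_cases i <;> simp)
  simpa [Fin.sum_univ_three] using this

/-- Extreme points are not in the convex hull of other points. -/
lemma notMem_convexHull_of_mem_extremePoints {P T : Set V} {x : V} (hP : Convex ℝ P)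
    (hx : x ∈ P.extremePoints ℝ) (hT : T ⊆ P) (hxT : x ∉ T) : x ∉ convexHull ℝ T := by
  intro h
  have := convexHull_min (subset_sdiff_singleton hT hxT)
    ((hP.mem_extremePoints_iff_convex_sdiff).1 hx).2 h
  exact this.2 rfl

/-- Three distinct extreme points are not collinear. -/
lemma signedArea_ne_zero {P : Set V} {a b c : V} (hP : Convex ℝ P)
    (ha : a ∈ P.extremePoints ℝ) (hb : b ∈ P.extremePoints ℝ) (hc : c ∈ P.extremePoints ℝ)
    (hab : a ≠ b) (hac : a ≠ c) (hbc : b ≠ c) : signedArea a b c ≠ 0 := by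
  intro h0
  have key : ∀ {x y z : V}, x ∈ P.extremePoints ℝ → y ∈ P.extremePoints ℝ →
      z ∈ P.extremePoints ℝ → x ≠ y → y ≠ z → ¬ Wbtw ℝ x y z := by
    intro x y z hx hy hz hxy hyz h
    refine notMem_convexHull_of_mem_extremePoints (T := {x, z}) hP hy ?_ ?_ ?_
    · rintro _ (rfl | rfl)
      exacts [hx.1, hz.1]
    · rintro (h | h)
      exacts [hxy h.symm, hyz h]
    · rwa [convexHull_pair, ← affineSegment_eq_segment]
  have hpos : 0 < (b.1 - a.1) ^ 2 + (b.2 - a.2) ^ 2 := by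
    by_contra hle
    apply hab
    ext <;> nlinarith [sq_nonneg (b.1 - a.1), sq_nonneg (b.2 - a.2)]
  have hcol : Collinear ℝ {a, b, c} := by
    rw [collinear_iff_of_mem (p₀ := a) (by simp)]
    refine ⟨b - a, ?_⟩
    rintro _ (rfl | rfl | rfl)
    · exact ⟨0, by simp⟩
    · exact ⟨1, by simp⟩
    · rename_i y
      refine ⟨((b.1 - a.1) * (y.1 - a.1) + (b.2 - a.2) * (y.2 - a.2)) /
        ((b.1 - a.1) ^ 2 + (b.2 - a.2) ^ 2), ?_⟩
      simp only [signedArea] at h0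
      ext
      · simp only [vadd_eq_add, Prod.fst_add, Prod.smul_fst, Prod.fst_sub, smul_eq_mul]
        field_simp
        linear_combination (-(b.2 - a.2)) * h0
      · simp only [vadd_eq_add, Prod.snd_add, Prod.smul_snd, Prod.snd_sub, smul_eq_mul]
        field_simp
        linear_combination (b.1 - a.1) * h0
  rcases hcol.wbtw_or_wbtw_or_wbtw with h | h | h
  · exact key ha hb hc hab hbc h
  · exact key hb hc ha hbc hac.symm h
  · exact key hc ha hb hac.symm hab h

/-- Four points in counterclockwise convex position. -/
structure IsCounterclockwise (a b c d : V) : Prop where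
  abc : 0 < signedArea a b c
  bcd : 0 < signedArea b c d
  cda : 0 < signedArea c d a
  dab : 0 < signedArea d a b

lemma IsCounterclockwise.rotate {a b c d : V} (h : IsCounterclockwise a b c d) :
    IsCounterclockwise b c d a :=
  ⟨h.bcd, h.cda, h.dab, h.abc⟩

lemma IsCounterclockwise.abd {a b c d : V} (h : IsCounterclockwise a b c d) :
    0 < signedArea a b d := by
  have := h.dab
  simp only [signedArea] at *
  linarith

lemma IsCounterclockwise.ne {a b c d : V} (h : IsCounterclockwise a b c d) : a ≠ b := by
  rintro rfl
  simpa [signedArea] using h.abc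

lemma IsCounterclockwise.ne_opposite {a b c d : V} (h : IsCounterclockwise a b c d) :
    a ≠ c := by
  rintro rfl
  have := h.abc
  simp only [signedArea] at this
  linarith

/-- The vertices of a convex quadrilateral can be listed in counterclockwise order. -/
lemma exists_isCounterclockwise {P : Set V} (hP : Convex ℝ P) {v : Fin 4 → V}
    (hv : Function.Injective v) (hext : P.extremePoints ℝ = range v) :
    ∃ a b c d, P.extremePoints ℝ = {a, b, c, d} ∧ IsCounterclockwise a b c d := by
  have hmem : ∀ i, v i ∈ P.extremePoints ℝ := fun i => hext ▸ mem_range_self i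
  have hZ : ∀ i j k, i ≠ j → i ≠ k → j ≠ k → signedArea (v i) (v j) (v k) ≠ 0 :=
    fun i j k hij hik hjk => signedArea_ne_zero hP (hmem i) (hmem j) (hmem k)
      (hv.ne hij) (hv.ne hik) (hv.ne hjk)
  have hN : ∀ l i j k, l ≠ i → l ≠ j → l ≠ k → 0 < signedArea (v i) (v j) (v k) →
      0 ≤ signedArea (v l) (v j) (v k) → 0 ≤ signedArea (v i) (v l) (v k) →
      0 ≤ signedArea (v i) (v j) (v l) → False := by
    intro l i j k hli hlj hlk h h1 h2 h3
    refine notMem_convexHull_of_mem_extremePoints hP (hmem l) ?_ ?_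
      (mem_convexHull_of_signedArea h h1 h2 h3)
    · rintro _ (rfl | rfl | rfl)
      exacts [(hmem _).1, (hmem _).1, (hmem _).1]
    · rintro (h | h | h)
      exacts [hli (hv h), hlj (hv h), hlk (hv h)]
  have hR : ∀ i j k l : Fin 4, (∀ m, m = i ∨ m = j ∨ m = k ∨ m = l) →
      P.extremePoints ℝ = {v i, v j, v k, v l} := by
    intro i j k l h
    rw [hext]
    apply Subset.antisymm
    · rintro _ ⟨m, rfl⟩
      rcases h m with rfl | rfl | rfl | rfl <;> simp
    · rintro _ (rfl | rfl | rfl | rfl) <;> exact mem_range_self _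
  have z0 := hZ 1 2 3 (by decide) (by decide) (by decide)
  have z1 := hZ 0 2 3 (by decide) (by decide) (by decide)
  have z2 := hZ 0 1 3 (by decide) (by decide) (by decide)
  have z3 := hZ 0 1 2 (by decide) (by decide) (by decide)
  have n0 := hN 0 1 2 3 (by decide) (by decide) (by decide)
  have n0' := hN 0 1 3 2 (by decide) (by decide) (by decide)
  have n1 := hN 1 0 2 3 (by decide) (by decide) (by decide)
  have n1' := hN 1 0 3 2 (by decide) (by decide) (by decide)
  have n2 := hN 2 0 1 3 (by decide) (by decide) (by decide)
  have n2' := hN 2 0 3 1 (by decide) (by decide) (by decide)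
  have n3 := hN 3 0 1 2 (by decide) (by decide) (by decide)
  have n3' := hN 3 0 2 1 (by decide) (by decide) (by decide)
  have r1 := fun h => (⟨_, _, _, _, hR 0 1 2 3 (by decide), h⟩ :
    ∃ a b c d, P.extremePoints ℝ = {a, b, c, d} ∧ IsCounterclockwise a b c d)
  have r2 := fun h => (⟨_, _, _, _, hR 0 3 2 1 (by decide), h⟩ :
    ∃ a b c d, P.extremePoints ℝ = {a, b, c, d} ∧ IsCounterclockwise a b c d)
  have r3 := fun h => (⟨_, _, _, _, hR 0 2 1 3 (by decide), h⟩ :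
    ∃ a b c d, P.extremePoints ℝ = {a, b, c, d} ∧ IsCounterclockwise a b c d)
  have r4 := fun h => (⟨_, _, _, _, hR 0 3 1 2 (by decide), h⟩ :
    ∃ a b c d, P.extremePoints ℝ = {a, b, c, d} ∧ IsCounterclockwise a b c d)
  have r5 := fun h => (⟨_, _, _, _, hR 0 1 3 2 (by decide), h⟩ :
    ∃ a b c d, P.extremePoints ℝ = {a, b, c, d} ∧ IsCounterclockwise a b c d)
  have r6 := fun h => (⟨_, _, _, _, hR 0 2 3 1 (by decide), h⟩ :
    ∃ a b c d, P.extremePoints ℝ = {a, b, c, d} ∧ IsCounterclockwise a b c d)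
  clear hZ hN hR hmem hext hv
  rcases z0.lt_or_gt with h0 | h0 <;> rcases z1.lt_or_gt with h1 | h1 <;>
    rcases z2.lt_or_gt with h2 | h2 <;> rcases z3.lt_or_gt with h3 | h3 <;>
    clear z0 z1 z2 z3 <;> simp only [signedArea] at h0 h1 h2 h3 <;>
    first
    | (apply r1; constructor <;> simp only [signedArea] <;> linarith)
    | (apply r2; constructor <;> simp only [signedArea] <;> linarith)
    | (apply r3; constructor <;> simp only [signedArea] <;> linarith)
    | (apply r4; constructor <;> simp only [signedArea] <;> linarith)
    | (apply r5; constructor <;> simp only [signedArea] <;> linarith)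
    | (apply r6; constructor <;> simp only [signedArea] <;> linarith)
    | (exfalso; apply n0 <;> simp only [signedArea] <;> linarith)
    | (exfalso; apply n0' <;> simp only [signedArea] <;> linarith)
    | (exfalso; apply n1 <;> simp only [signedArea] <;> linarith)
    | (exfalso; apply n1' <;> simp only [signedArea] <;> linarith)
    | (exfalso; apply n2 <;> simp only [signedArea] <;> linarith)
    | (exfalso; apply n2' <;> simp only [signedArea] <;> linarith)
    | (exfalso; apply n3 <;> simp only [signedArea] <;> linarith)
    | (exfalso; apply n3' <;> simp only [signedArea] <;> linarith)

lemma signedArea_nonneg_of_isCounterclockwise {P : Set V} {a b c d : V}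
    (hP : IsLatticePolytope P) (hext : P.extremePoints ℝ = {a, b, c, d})
    (h : IsCounterclockwise a b c d) : ∀ y ∈ P, 0 ≤ signedArea a b y := by
  have hfin : (P.extremePoints ℝ).Finite := hext ▸ toFinite _
  have hsub : P ⊆ {x | 0 ≤ signedArea a b x} := by
    rw [← hP.convexHull_extremePoints hfin, hext]
    refine convexHull_min ?_ (convex_signedArea_nonneg a b)
    rintro _ (rfl | rfl | rfl | rfl)
    · simp [signedArea]
    · simp [signedArea, mul_comm]
    · exact h.abc.le
    · exact h.abd.le
  exact hsub

lemma mem_endpoints_of_extremePoint {P : Set V} {x a b : V} (hx : x ∈ P.extremePoints ℝ)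
    (hab : segment ℝ a b ⊆ P) (hxab : x ∈ segment ℝ a b) : x = a ∨ x = b := by
  have := ((mem_extremePoints_iff_forall_segment).1 hx).2 a
    (hab (left_mem_segment ℝ a b)) b (hab (right_mem_segment ℝ a b)) hxab
  tauto

/-- Consecutive vertices of a convex quadrilateral span an edge. -/
lemma isEdge_of_isCounterclockwise {P : Set V} {a b c d : V} (hP : IsLatticePolytope P)
    (hext : P.extremePoints ℝ = {a, b, c, d}) (h : IsCounterclockwise a b c d) :
    IsEdge P (segment ℝ a b) := by
  have ha : a ∈ P.extremePoints ℝ := by simp [hext]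
  have hb : b ∈ P.extremePoints ℝ := by simp [hext]
  refine ⟨⟨a, b, h.ne, rfl⟩, fun x hx => ?_, ?_⟩
  · refine mem_frontier_of_signedArea h.ne (signedArea_nonneg_of_isCounterclockwise hP hext h)
      (hP.convex.segment_subset ha.1 hb.1 hx) ?_
    obtain ⟨s, t, -, -, hst, rfl⟩ := hx
    obtain rfl : s = 1 - t := by linarith
    simp only [signedArea, Prod.fst_add, Prod.snd_add, Prod.smul_fst, Prod.smul_snd,
      smul_eq_mul]
    ring
  · rintro _ ⟨x, y, rfl⟩ hF hE
    have hFP := hF.trans hP.isCompact.isClosed.frontier_subset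
    have h1 := mem_endpoints_of_extremePoint ha hFP (hE (left_mem_segment ℝ a b))
    have h2 := mem_endpoints_of_extremePoint hb hFP (hE (right_mem_segment ℝ a b))
    rcases h1 with rfl | rfl <;> rcases h2 with rfl | rfl
    · exact absurd rfl h.ne
    · rfl
    · exact segment_symm ℝ _ _
    · exact absurd rfl h.ne

/-- An edge of a toric diagram cannot be split between two lattice summands. -/
lemma eq_or_eq_of_isCounterclockwise {P A B : Set V} {a b c d a₁ a₂ b₁ b₂ : V}
    (hP : IsToricDiagram P) (hext : P.extremePoints ℝ = {a, b, c, d})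
    (h : IsCounterclockwise a b c d) (hAB : P = A + B)
    (ha₁ : a₁ ∈ A) (ha₂ : a₂ ∈ A) (hb₁ : b₁ ∈ B) (hb₂ : b₂ ∈ B)
    (la₁ : a₁ ∈ latticePoints) (lb₂ : b₂ ∈ latticePoints)
    (e₁ : a₁ + b₁ = a) (e₂ : a₂ + b₂ = b) : a₁ = a₂ ∨ b₁ = b₂ := by
  have hnn := signedArea_nonneg_of_isCounterclockwise hP.1 hext h
  have m₁ : a₁ + b₂ ∈ P := hAB ▸ add_mem_add ha₁ hb₂
  have m₂ : a₂ + b₁ ∈ P := hAB ▸ add_mem_add ha₂ hb₁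
  have p₁ := hnn _ m₁
  have p₂ := hnn _ m₂
  have hz : signedArea a b (a₁ + b₂) = 0 := by
    have : signedArea a b (a₁ + b₂) + signedArea a b (a₂ + b₁) = 0 := by
      subst e₁ e₂
      simp only [signedArea, Prod.fst_add, Prod.snd_add]
      ring
    linarith
  have hx := hP.2.2 _ (mem_frontier_of_signedArea h.ne hnn m₁ hz)
    (add_mem_latticePoints la₁ lb₂)
  rw [hext] at hx
  rcases hx with hx | hx | hx | hx
  · right
    exact (add_left_cancel (hx.trans e₁.symm)).symm
  · left
    exact add_right_cancel (hx.trans e₂.symm)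
  · have := h.abc
    rw [← hx, hz] at this
    exact absurd this (lt_irrefl _)
  · have := h.abd
    rw [← hx, hz] at this
    exact absurd this (lt_irrefl _)

lemma isLatticeSegment_and_edge {P A : Set V} {a b t : V} (ha : a ∈ latticePoints)
    (hb : b ∈ latticePoints) (hab : a ≠ b) (hA : A = segment ℝ a b)
    (hE : IsEdge P (segment ℝ (a + t) (b + t))) :
    IsLatticeSegment A ∧ ∃ (t : V) (E : Set V), IsEdge P E ∧ A = t +ᵥ E := by
  subst hA
  constructor
  · obtain ⟨a, rfl⟩ := ha
    obtain ⟨b, rfl⟩ := hb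
    exact ⟨a, b, fun h => hab (h ▸ rfl), rfl⟩
  · refine ⟨-t, _, hE, ?_⟩
    have := segment_translate_image ℝ (-t) (a + t) (b + t)
    rw [neg_add_cancel_comm_assoc, neg_add_cancel_comm_assoc] at this
    exact this.symm

/-- If two nonconstant cyclic sequences of length four are such that at each step one of them
is stationary, and opposite pairs differ, then they move alternately. -/
lemma alternate_of_cyclic {α β : Type*} {a0 a1 a2 a3 : α} {b0 b1 b2 b3 : β}
    (s0 : a0 = a1 ∨ b0 = b1) (s1 : a1 = a2 ∨ b1 = b2) (s2 : a2 = a3 ∨ b2 = b3)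
    (s3 : a3 = a0 ∨ b3 = b0) (nA : ¬ (a0 = a1 ∧ a0 = a2 ∧ a0 = a3))
    (nB : ¬ (b0 = b1 ∧ b0 = b2 ∧ b0 = b3)) (d02 : ¬ (a0 = a2 ∧ b0 = b2))
    (d13 : ¬ (a1 = a3 ∧ b1 = b3)) :
    (b0 = b1 ∧ a1 = a2 ∧ b2 = b3 ∧ a0 = a3) ∨
      (a0 = a1 ∧ b1 = b2 ∧ a2 = a3 ∧ b0 = b3) := by
  rcases s0 with rfl | rfl <;> rcases s1 with rfl | rfl <;> rcases s2 with rfl | rfl <;>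
    rcases s3 with h3 | h3 <;> grind

lemma convexHull_wrapped_pair (x y : V) : convexHull ℝ {x, y, y, x} = segment ℝ x y := by
  rw [← convexHull_pair, insert_idem, pair_comm y x, insert_idem]

lemma convexHull_doubled_pair (x y : V) : convexHull ℝ {x, x, y, y} = segment ℝ x y := by
  rw [← convexHull_pair, insert_idem, pair_eq_singleton]

/-- In a decomposition of a quadrilateral toric diagram, the quadrilateral is a parallelogram
and the summands are lattice segments that are translates of edges. -/
lemma decomposition_of_isCounterclockwise {P A B : Set V} {a b c d : V}
    (hP : IsToricDiagram P) (hext : P.extremePoints ℝ = {a, b, c, d})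
    (h : IsCounterclockwise a b c d) (hA : IsLatticePolytope A) (hB : IsLatticePolytope B)
    (hA1 : ¬ ∃ x, A = {x}) (hB1 : ¬ ∃ x, B = {x}) (hAB : P = A + B) :
    a + c = b + d ∧
    (IsLatticeSegment A ∧ ∃ (t : V) (E : Set V), IsEdge P E ∧ A = t +ᵥ E) ∧
    (IsLatticeSegment B ∧ ∃ (t : V) (E : Set V), IsEdge P E ∧ B = t +ᵥ E) := by
  have hfin : (P.extremePoints ℝ).Finite := hext ▸ toFinite _
  have hconv := hP.1.convexHull_extremePoints hfin
  have hr := h.rotate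
  have hrr := hr.rotate
  have hrrr := hrr.rotate
  have hext1 : P.extremePoints ℝ = {b, c, d, a} := by rw [hext]; grind
  have hext2 : P.extremePoints ℝ = {c, d, a, b} := by rw [hext]; grind
  have hext3 : P.extremePoints ℝ = {d, a, b, c} := by rw [hext]; grind
  have E0 := isEdge_of_isCounterclockwise hP.1 hext h
  have E1 := isEdge_of_isCounterclockwise hP.1 hext1 hr
  obtain ⟨a0, ha0, b0, hb0, e0⟩ := exists_extremePoints_add
    (show a ∈ (A + B).extremePoints ℝ by rw [← hAB, hext]; simp)
  obtain ⟨a1, ha1, b1, hb1, e1⟩ := exists_extremePoints_add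
    (show b ∈ (A + B).extremePoints ℝ by rw [← hAB, hext]; simp)
  obtain ⟨a2, ha2, b2, hb2, e2⟩ := exists_extremePoints_add
    (show c ∈ (A + B).extremePoints ℝ by rw [← hAB, hext]; simp)
  obtain ⟨a3, ha3, b3, hb3, e3⟩ := exists_extremePoints_add
    (show d ∈ (A + B).extremePoints ℝ by rw [← hAB, hext]; simp)
  have lA := hA.extremePoints_subset
  have lB := hB.extremePoints_subset
  have s0 := eq_or_eq_of_isCounterclockwise hP hext h hAB ha0.1 ha1.1 hb0.1 hb1.1
    (lA ha0) (lB hb1) e0 e1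
  have s1 := eq_or_eq_of_isCounterclockwise hP hext1 hr hAB ha1.1 ha2.1 hb1.1 hb2.1
    (lA ha1) (lB hb2) e1 e2
  have s2 := eq_or_eq_of_isCounterclockwise hP hext2 hrr hAB ha2.1 ha3.1 hb2.1 hb3.1
    (lA ha2) (lB hb3) e2 e3
  have s3 := eq_or_eq_of_isCounterclockwise hP hext3 hrrr hAB ha3.1 ha0.1 hb3.1 hb0.1
    (lA ha3) (lB hb0) e3 e0
  have hsub : P ⊆ convexHull ℝ (({a0, a1, a2, a3} : Set V) + {b0, b1, b2, b3}) := by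
    rw [← hconv, hext]
    apply convexHull_mono
    rintro _ (rfl | rfl | rfl | rfl)
    · exact ⟨a0, by simp, b0, by simp, e0⟩
    · exact ⟨a1, by simp, b1, by simp, e1⟩
    · exact ⟨a2, by simp, b2, by simp, e2⟩
    · exact ⟨a3, by simp, b3, by simp, e3⟩
  have hSA : ({a0, a1, a2, a3} : Set V) ⊆ A := by
    rintro _ (rfl | rfl | rfl | rfl)
    exacts [ha0.1, ha1.1, ha2.1, ha3.1]
  have hTB : ({b0, b1, b2, b3} : Set V) ⊆ B := by
    rintro _ (rfl | rfl | rfl | rfl)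
    exacts [hb0.1, hb1.1, hb2.1, hb3.1]
  have cA : A = convexHull ℝ {a0, a1, a2, a3} :=
    eq_convexHull_of_add hA hB (toFinite _) hSA hTB (hAB ▸ hsub)
  have cB : B = convexHull ℝ {b0, b1, b2, b3} :=
    eq_convexHull_of_add hB hA (toFinite _) hTB hSA (by
      rw [add_comm B, ← hAB, add_comm]
      exact hsub)
  have nA : ¬ (a0 = a1 ∧ a0 = a2 ∧ a0 = a3) := by
    rintro ⟨rfl, rfl, rfl⟩
    exact hA1 ⟨a0, by simpa using cA⟩
  have nB : ¬ (b0 = b1 ∧ b0 = b2 ∧ b0 = b3) := by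
    rintro ⟨rfl, rfl, rfl⟩
    exact hB1 ⟨b0, by simpa using cB⟩
  have d01 : ¬ (a0 = a1 ∧ b0 = b1) := fun ⟨p, q⟩ => h.ne (by rw [← e0, ← e1, p, q])
  have d12 : ¬ (a1 = a2 ∧ b1 = b2) := fun ⟨p, q⟩ => hr.ne (by rw [← e1, ← e2, p, q])
  have d02 : ¬ (a0 = a2 ∧ b0 = b2) := fun ⟨p, q⟩ => h.ne_opposite (by rw [← e0, ← e2, p, q])
  have d13 : ¬ (a1 = a3 ∧ b1 = b3) := fun ⟨p, q⟩ => hr.ne_opposite (by rw [← e1, ← e3, p, q])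
  have hcases : (b0 = b1 ∧ a1 = a2 ∧ b2 = b3 ∧ a0 = a3) ∨
      (a0 = a1 ∧ b1 = b2 ∧ a2 = a3 ∧ b0 = b3) :=
    alternate_of_cyclic s0 s1 s2 s3 nA nB d02 d13
  rw [← e0, ← e1] at E0
  rw [← e1, ← e2] at E1
  rw [← e0, ← e1, ← e2, ← e3]
  rcases hcases with ⟨rfl, rfl, rfl, rfl⟩ | ⟨rfl, rfl, rfl, rfl⟩
  · refine ⟨by abel, isLatticeSegment_and_edge (lA ha0) (lA ha1) ?_
      (cA.trans (convexHull_wrapped_pair _ _)) E0,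
      isLatticeSegment_and_edge (t := a1) (lB hb0) (lB hb2) ?_
      (cB.trans (convexHull_doubled_pair _ _)) ?_⟩
    · exact fun e => d01 ⟨e, rfl⟩
    · exact fun e => d12 ⟨rfl, e⟩
    · rwa [add_comm b0, add_comm b2]
  · refine ⟨by abel, isLatticeSegment_and_edge (t := b1) (lA ha0) (lA ha2) ?_
      (cA.trans (convexHull_doubled_pair _ _)) E1,
      isLatticeSegment_and_edge (t := a0) (lB hb0) (lB hb1) ?_
      (cB.trans (convexHull_wrapped_pair _ _)) ?_⟩
    · exact fun e => d12 ⟨e, rfl⟩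
    · exact fun e => d01 ⟨rfl, e⟩
    · rwa [add_comm b0, add_comm b1]

/-- A lattice parallelogram is the Minkowski sum of two lattice segments. -/
lemma exists_decomposition_of_isParallelogram {P : Set V} (hP : IsLatticePolytope P)
    (h : IsParallelogram P) : ∃ A B : Set V, IsLatticePolytope A ∧ IsLatticePolytope B ∧
      (¬ ∃ x, A = {x}) ∧ (¬ ∃ x, B = {x}) ∧ P = A + B := by
  obtain ⟨w, hw, hext, hsum⟩ := h
  have hl : ∀ i, w i ∈ latticePoints := fun i =>
    hP.extremePoints_subset (hext ▸ mem_range_self i)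
  have hdiff : w 3 - w 0 ∈ latticePoints := by
    obtain ⟨p, hp⟩ := hl 3
    obtain ⟨q, hq⟩ := hl 0
    exact ⟨p - q, by rw [← hp, ← hq]; simp [toR]⟩
  refine ⟨segment ℝ (w 0) (w 1), segment ℝ 0 (w 3 - w 0),
    isLatticePolytope_segment (hl 0) (hl 1),
    isLatticePolytope_segment ⟨0, by simp [toR]⟩ hdiff,
    segment_ne_singleton (hw.ne (by decide)), segment_ne_singleton ?_, ?_⟩
  · exact (sub_ne_zero.2 (hw.ne (by decide))).symm
  · rw [← convexHull_pair, ← convexHull_pair, ← convexHull_add,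
      ← hP.convexHull_extremePoints (hext ▸ finite_range w), hext]
    have h2 : w 1 + (w 3 - w 0) = w 2 := by
      rw [← add_sub_assoc, ← hsum]; abel
    congr 1
    rw [insert_eq (w 0), union_add, singleton_add, singleton_add, image_pair, image_pair, h2]
    ext x
    simp only [mem_range, Fin.exists_fin_succ]
    simp
    grind

/-- A toric diagram with exactly four extreme points admits a Minkowski
decomposition `P = A + B` into two lattice polytopes neither of which is a single point
iff `P` is a parallelogram; in that case `A` and `B` are necessarily lattice segments,
namely translates of the two edges of `P`. -/
theorem statement3 (P : Set V) (hP : IsToricDiagram P)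
    (h4 : ∃ v : Fin 4 → V, Function.Injective v ∧ P.extremePoints ℝ = Set.range v) :
    ((∃ A B : Set V, IsLatticePolytope A ∧ IsLatticePolytope B ∧
        (¬ ∃ x, A = {x}) ∧ (¬ ∃ x, B = {x}) ∧ P = A + B) ↔ IsParallelogram P) ∧
    (∀ A B : Set V, IsLatticePolytope A → IsLatticePolytope B →
        (¬ ∃ x, A = {x}) → (¬ ∃ x, B = {x}) → P = A + B →
        IsLatticeSegment A ∧ IsLatticeSegment B ∧
        (∃ (t : V) (E : Set V), IsEdge P E ∧ A = t +ᵥ E) ∧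
        (∃ (t : V) (E : Set V), IsEdge P E ∧ B = t +ᵥ E)) := by
  obtain ⟨v, hv, hext⟩ := h4
  obtain ⟨a, b, c, d, hext', hccw⟩ := exists_isCounterclockwise hP.1.convex hv hext
  refine ⟨⟨?_, exists_decomposition_of_isParallelogram hP.1⟩, ?_⟩
  · rintro ⟨A, B, hA, hB, hA1, hB1, hAB⟩
    refine ⟨![a, b, c, d], ?_, ?_,
      (decomposition_of_isCounterclockwise hP hext' hccw hA hB hA1 hB1 hAB).1⟩
    · have h1 := hccw.ne
      have h2 := hccw.rotate.ne
      have h3 := hccw.rotate.rotate.ne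
      have h4 := hccw.rotate.rotate.rotate.ne
      have h5 := hccw.ne_opposite
      have h6 := hccw.rotate.ne_opposite
      intro i j hij
      fin_cases i <;> fin_cases j <;> simp_all
    · rw [hext']
      ext x
      simp [eq_comm]
      tauto
  · intro A B hA hB hA1 hB1 hAB
    obtain ⟨-, ⟨hA2, hA3⟩, hB2, hB3⟩ :=
      decomposition_of_isCounterclockwise hP hext' hccw hA hB hA1 hB1 hAB
    exact ⟨hA2, hB2, hA3, hB3⟩
end
end
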